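/- The Wang set 𝒯 of 11 tiles is aperiodic: 𝒯 tiles the plane, and no tiling of ℤ² by 𝒯 is periodic. -/

import Mathlib

structure WangTile (H V : Type*) where
  west : H
  east : H
  south : V
  north : V
deriving DecidableEq

def TilingOn {H V : Type*} (T : Set (WangTile H V)) (X : Set (ℤ × ℤ))
    (f : ℤ × ℤ → WangTile H V) : Prop :=
  (∀ p ∈ X, f p ∈ T) ∧
  (∀ x y : ℤ, (x, y) ∈ X → (x + 1, y) ∈ X →
    (f (x, y)).east = (f (x + 1, y)).west) ∧
  (∀ x y : ℤ, (x, y) ∈ X → (x, y + 1) ∈ X →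
    (f (x, y)).north = (f (x, y + 1)).south)

def Tiling {H V : Type*} (T : Set (WangTile H V)) (f : ℤ × ℤ → WangTile H V) : Prop :=
  TilingOn T Set.univ f

def TilesPlane {H V : Type*} (T : Set (WangTile H V)) : Prop :=
  ∃ f, Tiling T f

def PeriodicTiling {H V : Type*} (f : ℤ × ℤ → WangTile H V) : Prop :=
  ∃ u v : ℤ, (u, v) ≠ (0, 0) ∧ ∀ x y : ℤ, f (x + u, y + v) = f (x, y)

def Aperiodic {H V : Type*} (T : Set (WangTile H V)) : Prop :=
  TilesPlane T ∧ ∀ f, Tiling T f → ¬ PeriodicTiling f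

def MinimallyAperiodic {H V : Type*} (T : Set (WangTile H V)) : Prop :=
  Aperiodic T ∧ ∀ S : Set (WangTile H V), S ⊂ T → ¬ TilesPlane S

/-- The nine tiles `𝒯₀` of the 11-tile Wang set `𝒯`.  Horizontal (west/east) colors in
`Fin 4`, vertical (south/north) colors in `Fin 5`.  Tiles are written
`⟨west, east, south, north⟩`. -/
def T₀ : Set (WangTile (Fin 4) (Fin 5)) :=
  { ⟨0, 0, 1, 0⟩, ⟨0, 3, 2, 1⟩, ⟨1, 0, 2, 2⟩, ⟨1, 1, 4, 2⟩, ⟨1, 3, 2, 3⟩,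
    ⟨3, 0, 1, 1⟩, ⟨3, 1, 1, 1⟩, ⟨3, 1, 2, 2⟩, ⟨3, 3, 3, 1⟩ }

/-- The two tiles `𝒯₁` of the 11-tile Wang set `𝒯`. -/
def T₁ : Set (WangTile (Fin 4) (Fin 5)) := { ⟨2, 2, 1, 4⟩, ⟨2, 2, 0, 2⟩ }

/-- The 11-tile Wang set `𝒯 = 𝒯₀ ∪ 𝒯₁`. -/
def T11 : Set (WangTile (Fin 4) (Fin 5)) := T₀ ∪ T₁

/-- The horizontal strip `ℤ × {0, …, m}`. -/
def strip (m : ℕ) : Set (ℤ × ℤ) := {p : ℤ × ℤ | 0 ≤ p.2 ∧ p.2 ≤ (m : ℤ)}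


namespace JR

/-! ### Transducers (labelled graphs) and their bi-infinite rows -/

/-- An edge of a transducer: from state `w` to state `e`, reading `s` and writing `n`. -/
structure Ed where
  w : ℕ
  e : ℕ
  s : ℕ
  n : ℕ
deriving DecidableEq

/-- Bi-infinite words. -/
abbrev Wd := ℤ → ℕ

def sh (k : ℤ) (u : Wd) : Wd := fun t => u (t + k)

def IsRow (X : List Ed) (r : ℤ → Ed) : Prop :=
  ∀ t, r t ∈ X ∧ (r t).e = (r (t + 1)).w

def RelW (X : List Ed) (u v : Wd) : Prop :=
  ∃ r, IsRow X r ∧ (∀ t, u t = (r t).s) ∧ ∀ t, v t = (r t).n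

theorem RelW.shift {X u v} (h : RelW X u v) (k : ℤ) : RelW X (sh k u) (sh k v) := by
  obtain ⟨r, hr, hu, hv⟩ := h
  refine ⟨fun t => r (t + k), fun t => ⟨(hr _).1, ?_⟩, fun t => hu _, fun t => hv _⟩
  have := (hr (t + k)).2
  rwa [show t + k + 1 = t + 1 + k by ring] at this

theorem RelW.nil {u v} (h : RelW [] u v) : False := by
  obtain ⟨r, hr, -⟩ := h
  simpa using (hr 0).1

theorem RelW.mono {X Y u v} (h : RelW X u v) (hXY : ∀ e ∈ X, e ∈ Y) : RelW Y u v := by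
  obtain ⟨r, hr, hu, hv⟩ := h
  exact ⟨r, fun t => ⟨hXY _ (hr t).1, (hr t).2⟩, hu, hv⟩

/-- The set of the numbers `f a`, `a ∈ X`, as a bit mask. -/
def mask (f : Ed → ℕ) (X : List Ed) : ℕ := X.foldr (fun a m => 1 <<< f a ||| m) 0

theorem mask_of_mem (f : Ed → ℕ) {X : List Ed} {a : Ed} (h : a ∈ X) :
    (mask f X).testBit (f a) = true := by
  induction X with
  | nil => simp at h
  | cons b X ih =>
    simp only [mask, List.foldr_cons, Nat.testBit_or, Bool.or_eq_true]
    rcases List.mem_cons.1 h with rfl | h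
    · left; simp [Nat.one_shiftLeft]
    · right; exact ih h

/-- Keep only edges with a successor and a predecessor. -/
def trim1 (X : List Ed) : List Ed :=
  X.filter fun a => (mask Ed.w X).testBit a.e && (mask Ed.e X).testBit a.w

def trim : ℕ → List Ed → List Ed
  | 0, X => X
  | k + 1, X => trim k (trim1 X)

theorem RelW.trim1 {X u v} (h : RelW X u v) : RelW (trim1 X) u v := by
  obtain ⟨r, hr, hu, hv⟩ := h
  refine ⟨r, fun t => ⟨?_, (hr t).2⟩, hu, hv⟩
  simp only [JR.trim1, List.mem_filter, Bool.and_eq_true]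
  refine ⟨(hr t).1, ?_, ?_⟩
  · rw [(hr t).2]; exact mask_of_mem Ed.w (hr (t + 1)).1
  · have := (hr (t - 1)).2
    rw [sub_add_cancel] at this
    rw [← this]; exact mask_of_mem Ed.e (hr (t - 1)).1

theorem RelW.trim {u v} (k : ℕ) : ∀ {X}, RelW X u v → RelW (trim k X) u v := by
  induction k with
  | zero => exact fun h => h
  | succ k ih => exact fun h => ih h.trim1

/-- Composition of transducers; `K` is only used to number the states. -/
def comp (K : ℕ) (X Y : List Ed) : List Ed :=
  X.flatMap fun a => (Y.filter fun b => a.n == b.s).map fun b =>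
    ⟨a.w * K + b.w, a.e * K + b.e, a.s, b.n⟩

theorem RelW.comp {X Y u v v'} (K : ℕ) (h : RelW X u v) (h' : RelW Y v v') :
    RelW (comp K X Y) u v' := by
  obtain ⟨r, hr, hu, hv⟩ := h
  obtain ⟨r', hr', hu', hv'⟩ := h'
  refine ⟨fun t => ⟨(r t).w * K + (r' t).w, (r t).e * K + (r' t).e, (r t).s, (r' t).n⟩,
    fun t => ⟨?_, ?_⟩, hu, hv'⟩
  · simp only [JR.comp, List.mem_flatMap, List.mem_map, List.mem_filter, beq_iff_eq]
    exact ⟨r t, (hr t).1, r' t, ⟨(hr' t).1, by rw [← hv, ← hu']⟩, rfl⟩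
  · simp only [(hr t).2, (hr' t).2]

/-- Renaming of states. -/
def ren (f : ℕ → ℕ) (X : List Ed) : List Ed := X.map fun a => ⟨f a.w, f a.e, a.s, a.n⟩

theorem RelW.ren {X u v} (f : ℕ → ℕ) (h : RelW X u v) : RelW (ren f X) u v := by
  obtain ⟨r, hr, hu, hv⟩ := h
  refine ⟨fun t => ⟨f (r t).w, f (r t).e, (r t).s, (r t).n⟩, fun t => ⟨?_, ?_⟩, hu, hv⟩
  · exact List.mem_map.2 ⟨r t, (hr t).1, rfl⟩
  · simp only [(hr t).2]

/-- Letters written are `0` or `1`. -/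
def out01 (X : List Ed) : List Ed := X.filter fun a => decide (a.n < 2)

theorem RelW.out01 {X u v} (h : RelW X u v) (hv : ∀ t, v t < 2) : RelW (out01 X) u v := by
  obtain ⟨r, hr, hu, hv'⟩ := h
  refine ⟨r, fun t => ⟨?_, (hr t).2⟩, hu, hv'⟩
  simp only [JR.out01, List.mem_filter, decide_eq_true_eq]
  exact ⟨(hr t).1, by rw [← hv']; exact hv t⟩

theorem RelW.in_lt {X u v} (h : RelW X u v) (k : ℕ) (hX : ∀ a ∈ X, a.s < k) (t : ℤ) : u t < k := by
  obtain ⟨r, hr, hu, hv'⟩ := h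
  rw [hu]; exact hX _ (hr t).1

/-- The state renaming coded by `L`: the entry `64 * s + k` sends `s` to `k`. -/
def look (L : List ℕ) (s : ℕ) : ℕ := ((L.find? fun x => x / 64 == s).getD 0) % 64

def sub (X Z : List Ed) : Bool := X.all fun a => decide (a ∈ Z)

theorem RelW.sub {X Z u v} (h : RelW X u v) (hX : sub X Z = true) : RelW Z u v :=
  h.mono fun e he => by
    simpa using List.all_eq_true.1 hX e he

theorem RelW.cert {X Y Z u w v} (h : RelW X u w) (h' : RelW Y w v) (K k : ℕ) (L : List ℕ)
    (hc : JR.sub (JR.ren (look L) (JR.trim k (JR.comp K X Y))) Z = true) : RelW Z u v :=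
  (((h.comp K h').trim k).ren _).sub hc

theorem RelW.certL {X Y Z u w v} (h : RelW X u w) (h' : RelW Y w v) (K k : ℕ) (L : List ℕ)
    (hv : ∀ t, v t < 2)
    (hc : JR.sub (JR.ren (look L) (JR.trim k (JR.out01 (JR.comp K X Y)))) Z = true) :
    RelW Z u v :=
  ((((h.comp K h').out01 hv).trim k).ren _).sub hc

/-! ### The tile rows -/

def X0 : List Ed := [⟨0,0,1,0⟩, ⟨0,3,2,1⟩, ⟨1,0,2,2⟩, ⟨1,1,4,2⟩, ⟨1,3,2,3⟩, ⟨3,0,1,1⟩, ⟨3,1,1,1⟩,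
  ⟨3,1,2,2⟩, ⟨3,3,3,1⟩]
def X1 : List Ed := [⟨2,2,1,4⟩, ⟨2,2,0,2⟩]

theorem cX11 {u w v} (h : RelW X1 u w) (h' : RelW X1 w v) :
    RelW [] u v :=
  h.cert h' 64 0 []
    (by decide +kernel)

def X10 : List Ed := [⟨0,2,0,1⟩, ⟨1,0,0,2⟩, ⟨1,1,1,2⟩, ⟨1,2,0,3⟩, ⟨2,1,0,2⟩]
theorem cX10 {u w v} (h : RelW X1 u w) (h' : RelW X0 w v) :
    RelW X10 u v :=
  h.cert h' 64 0 [8192, 8257, 8386]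
    (by decide +kernel)

theorem cX101 {u w v} (h : RelW X10 u w) (h' : RelW X1 w v) :
    RelW [] u v :=
  h.cert h' 64 1 []
    (by decide +kernel)

def X100 : List Ed := [⟨0,5,0,0⟩, ⟨1,3,1,1⟩, ⟨1,4,0,1⟩, ⟨2,0,0,2⟩, ⟨2,1,1,2⟩, ⟨2,3,1,3⟩,
  ⟨2,4,0,3⟩, ⟨3,2,1,2⟩, ⟨3,7,0,1⟩, ⟨4,5,0,1⟩, ⟨4,6,0,1⟩, ⟨5,3,0,1⟩, ⟨6,1,0,2⟩, ⟨6,3,0,3⟩,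
  ⟨7,2,0,2⟩]
theorem cX100 {u w v} (h : RelW X10 u w) (h' : RelW X0 w v) :
    RelW X100 u v :=
  h.cert h' 64 1 [0, 196, 4097, 4162, 4291, 8197, 8262, 8391]
    (by decide +kernel)

theorem cX1001 {u w v} (h : RelW X100 u w) (h' : RelW X1 w v) :
    RelW [] u v :=
  h.cert h' 64 2 []
    (by decide +kernel)

def XA : List Ed := [⟨0,4,1,1⟩, ⟨0,7,0,0⟩, ⟨1,2,0,0⟩, ⟨2,0,0,0⟩, ⟨2,3,0,1⟩, ⟨3,0,1,1⟩, ⟨3,1,0,1⟩,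
  ⟨4,5,1,1⟩, ⟨4,6,0,1⟩, ⟨5,7,0,1⟩, ⟨6,2,0,1⟩, ⟨7,4,0,1⟩]
theorem cXA {u w v} (h : RelW X100 u w) (h' : RelW X0 w v)
    (hv : ∀ t, v t < 2) :
    RelW XA u v :=
  h.certL h' 64 1 [4291, 8388, 12288, 12485, 16385, 16582, 20482, 24578, 28679]
    hv (by decide +kernel)

def X1000 : List Ed := [⟨0,5,1,0⟩, ⟨0,8,0,0⟩, ⟨1,0,1,2⟩, ⟨1,3,1,3⟩, ⟨2,3,1,1⟩, ⟨3,5,1,1⟩,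
  ⟨3,6,1,1⟩, ⟨3,8,0,1⟩, ⟨4,7,1,1⟩, ⟨4,9,0,1⟩, ⟨5,4,1,1⟩, ⟨5,12,0,0⟩, ⟨6,2,1,2⟩, ⟨6,4,1,3⟩,
  ⟨7,1,1,2⟩, ⟨7,12,0,1⟩, ⟨7,13,0,1⟩, ⟨8,11,0,0⟩, ⟨9,10,0,1⟩, ⟨9,11,0,1⟩, ⟨10,0,0,2⟩, ⟨10,3,0,3⟩,
  ⟨11,3,0,1⟩, ⟨11,5,0,0⟩, ⟨12,4,0,1⟩, ⟨13,2,0,2⟩, ⟨13,4,0,3⟩]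
theorem cX1000 {u w v} (h : RelW X100 u w) (h' : RelW X0 w v) :
    RelW X1000 u v :=
  h.cert h' 64 1 [4096, 4291, 8194, 8257, 8388, 12293, 12358, 12487, 16392, 16585, 20491, 24587,
  24650, 28684, 28749]
    (by decide +kernel)

def XB : List Ed := [⟨0,2,1,0⟩, ⟨1,6,1,0⟩, ⟨1,7,0,0⟩, ⟨2,1,1,0⟩, ⟨2,4,1,1⟩, ⟨3,5,1,1⟩, ⟨4,0,1,1⟩,
  ⟨5,2,1,1⟩, ⟨6,3,1,1⟩, ⟨6,9,0,0⟩, ⟨7,8,0,0⟩, ⟨8,0,0,0⟩, ⟨9,1,0,0⟩, ⟨9,4,0,1⟩]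
theorem cXB {u w v} (h : RelW X1000 u w) (h' : RelW X0 w v)
    (hv : ∀ t, v t < 2) :
    RelW XB u v :=
  h.certL h' 64 2 [4291, 8388, 12288, 12485, 16385, 20482, 24578, 28678, 36871, 45064, 49161,
  53257]
    hv (by decide +kernel)

def X00 : List Ed := [⟨0,5,2,0⟩, ⟨1,3,4,1⟩, ⟨1,4,2,1⟩, ⟨2,0,2,2⟩, ⟨2,1,4,2⟩, ⟨2,3,4,3⟩, ⟨2,4,2,3⟩,
  ⟨3,2,4,2⟩, ⟨3,6,2,1⟩, ⟨4,5,2,1⟩, ⟨4,7,2,1⟩, ⟨5,0,1,0⟩, ⟨5,1,1,0⟩, ⟨5,3,2,1⟩, ⟨5,5,3,0⟩,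
  ⟨6,0,1,1⟩, ⟨6,1,1,1⟩, ⟨6,2,1,1⟩, ⟨6,2,2,2⟩, ⟨6,5,3,1⟩, ⟨6,7,3,1⟩, ⟨7,1,2,2⟩, ⟨7,3,2,3⟩]
theorem cX00 {u w v} (h : RelW X0 u w) (h' : RelW X0 w v) :
    RelW X00 u v :=
  h.cert h' 64 1 [0, 196, 4097, 4162, 4291, 12293, 12359, 12486]
    (by decide +kernel)

def X000 : List Ed := [⟨0,5,4,0⟩, ⟨0,8,2,0⟩, ⟨1,0,4,2⟩, ⟨1,3,4,3⟩, ⟨2,3,4,1⟩, ⟨3,5,4,1⟩,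
  ⟨3,6,4,1⟩, ⟨3,8,2,1⟩, ⟨4,7,4,1⟩, ⟨4,9,2,1⟩, ⟨5,4,4,1⟩, ⟨5,12,2,0⟩, ⟨6,2,4,2⟩, ⟨6,4,4,3⟩,
  ⟨7,1,4,2⟩, ⟨7,10,2,1⟩, ⟨7,12,2,1⟩, ⟨8,11,2,0⟩, ⟨9,11,2,1⟩, ⟨9,13,2,1⟩, ⟨10,2,2,2⟩, ⟨10,4,2,3⟩,
  ⟨11,3,2,1⟩, ⟨11,5,2,0⟩, ⟨12,0,1,0⟩, ⟨12,2,1,0⟩, ⟨12,4,2,1⟩, ⟨12,11,3,0⟩, ⟨13,0,2,2⟩, ⟨13,3,2,3⟩]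
theorem cX000 {u w v} (h : RelW X00 u w) (h' : RelW X0 w v) :
    RelW X000 u v :=
  h.cert h' 64 1 [4096, 4291, 8194, 8257, 8388, 12293, 12358, 12487, 16392, 16585, 20491, 24588,
  24650, 28683, 28749]
    (by decide +kernel)

theorem cX00000 {u w v} (h : RelW X000 u w) (h' : RelW X00 w v) :
    RelW [] u v :=
  h.cert h' 64 4 []
    (by decide +kernel)

theorem cXAA {u w v} (h : RelW XA u w) (h' : RelW XA w v) :
    RelW [] u v :=
  h.cert h' 64 6 []
    (by decide +kernel)

def XAB : List Ed := [⟨0,19,1,0⟩, ⟨1,30,1,0⟩, ⟨2,17,1,0⟩, ⟨2,26,1,1⟩, ⟨3,28,1,1⟩, ⟨4,16,1,1⟩,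
  ⟨5,19,1,1⟩, ⟨6,23,1,1⟩, ⟨7,9,0,0⟩, ⟨7,36,0,1⟩, ⟨8,47,0,0⟩, ⟨9,48,0,0⟩, ⟨9,51,0,1⟩, ⟨10,8,0,0⟩,
  ⟨11,1,0,0⟩, ⟨11,4,0,1⟩, ⟨12,35,0,0⟩, ⟨13,40,0,0⟩, ⟨14,35,0,1⟩, ⟨15,34,0,0⟩, ⟨15,37,0,1⟩,
  ⟨16,9,1,0⟩, ⟨16,22,0,0⟩, ⟨17,31,0,0⟩, ⟨17,46,1,0⟩, ⟨18,15,0,0⟩, ⟨19,21,0,0⟩, ⟨19,27,0,1⟩,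
  ⟨19,42,1,0⟩, ⟨19,44,1,1⟩, ⟨20,39,0,1⟩, ⟨21,7,0,0⟩, ⟨22,13,0,0⟩, ⟨22,24,0,1⟩, ⟨23,29,0,1⟩,
  ⟨23,45,1,1⟩, ⟨24,32,0,1⟩, ⟨25,14,0,1⟩, ⟨26,18,0,1⟩, ⟨26,41,1,1⟩, ⟨27,12,0,1⟩, ⟨28,9,1,1⟩,
  ⟨28,22,0,1⟩, ⟨29,15,0,1⟩, ⟨30,25,0,1⟩, ⟨30,43,1,1⟩, ⟨31,20,0,1⟩, ⟨32,2,1,0⟩, ⟨33,10,0,0⟩,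
  ⟨34,6,1,0⟩, ⟨34,38,0,0⟩, ⟨35,1,1,0⟩, ⟨35,4,1,1⟩, ⟨35,33,0,0⟩, ⟨36,5,1,1⟩, ⟨37,0,1,1⟩,
  ⟨38,11,0,0⟩, ⟨39,2,1,1⟩, ⟨40,3,1,1⟩, ⟨41,49,0,0⟩, ⟨42,53,0,0⟩, ⟨43,52,0,1⟩, ⟨44,47,0,1⟩,
  ⟨45,49,0,1⟩, ⟨46,50,0,1⟩, ⟨47,19,0,0⟩, ⟨48,30,0,0⟩, ⟨49,17,0,0⟩, ⟨49,26,0,1⟩, ⟨50,28,0,1⟩,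
  ⟨51,16,0,1⟩, ⟨52,19,0,1⟩, ⟨53,23,0,1⟩]
theorem cXAB {u w v} (h : RelW XA u w) (h' : RelW XB w v) :
    RelW XAB u v :=
  h.cert h' 64 2 [0, 65, 130, 195, 260, 325, 390, 520, 585, 4193, 4518, 8204, 8269, 8335, 8404,
  8472, 8526, 8583, 8650, 8779, 12320, 12386, 12451, 12516, 12581, 12647, 12712, 16400, 16465,
  16531, 16599, 16666, 16732, 16798, 20521, 20586, 20617, 20715, 20780, 20845, 20910, 24594,
  24661, 24726, 24793, 24859, 24925, 24991, 28719, 28784, 28849, 28914, 28979, 29044, 29109]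
    (by decide +kernel)

def XABA : List Ed := [⟨0,7,0,0⟩, ⟨1,21,0,0⟩, ⟨2,23,0,1⟩, ⟨3,1,0,1⟩, ⟨4,6,0,1⟩, ⟨5,19,0,1⟩,
  ⟨6,21,0,1⟩, ⟨7,24,0,1⟩, ⟨8,2,0,1⟩, ⟨9,22,0,1⟩, ⟨10,18,0,1⟩, ⟨11,33,1,1⟩, ⟨12,9,0,1⟩, ⟨13,0,0,0⟩,
  ⟨13,3,0,1⟩, ⟨14,44,0,1⟩, ⟨15,36,0,1⟩, ⟨16,8,0,1⟩, ⟨17,51,0,1⟩, ⟨18,42,0,1⟩, ⟨19,13,0,1⟩,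
  ⟨19,29,1,1⟩, ⟨20,11,0,1⟩, ⟨21,26,0,0⟩, ⟨21,37,0,1⟩, ⟨22,16,0,1⟩, ⟨23,46,0,1⟩, ⟨24,39,0,1⟩,
  ⟨25,47,0,1⟩, ⟨26,12,0,1⟩, ⟨26,40,0,0⟩, ⟨27,32,1,1⟩, ⟨27,45,0,0⟩, ⟨28,34,0,1⟩, ⟨29,41,1,1⟩,
  ⟨30,33,0,1⟩, ⟨31,27,0,1⟩, ⟨32,38,1,1⟩, ⟨33,45,0,1⟩, ⟨34,20,0,1⟩, ⟨35,29,0,1⟩, ⟨36,14,0,1⟩,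
  ⟨37,7,1,1⟩, ⟨37,48,0,1⟩, ⟨38,40,0,1⟩, ⟨39,43,1,1⟩, ⟨39,50,0,1⟩, ⟨40,30,0,1⟩, ⟨41,17,1,1⟩,
  ⟨41,49,0,1⟩, ⟨42,4,0,1⟩, ⟨43,25,0,1⟩, ⟨44,35,0,1⟩, ⟨45,41,0,1⟩, ⟨46,43,1,0⟩, ⟨46,50,0,0⟩,
  ⟨47,15,0,1⟩, ⟨48,5,0,1⟩, ⟨48,28,0,0⟩, ⟨49,10,0,1⟩, ⟨50,31,0,1⟩, ⟨51,38,0,1⟩]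
theorem cXABA {u w v} (h : RelW XAB u w) (h' : RelW XA w v) :
    RelW XABA u v :=
  h.cert h' 64 9 [4253, 20768, 28828, 28895, 28958, 32833, 32898, 33158, 33223, 36955, 37090,
  37281, 40960, 41155, 41220, 41352, 45475, 49413, 49481, 57610, 61796, 65803, 77850, 77934,
  78053, 78182, 78247, 86128, 86194, 86504, 94255, 102449, 110640, 110860, 119055, 123113, 135309,
  135440, 135658, 139726, 143698, 143763, 143830, 147483, 155948, 172203, 176145, 180231, 192661,
  192727, 192792, 196781, 208916, 213299, 217305]
    (by decide +kernel)

def XBA : List Ed := [⟨0,15,1,0⟩, ⟨1,9,1,0⟩, ⟨2,10,1,1⟩, ⟨2,11,1,0⟩, ⟨3,8,1,1⟩, ⟨4,14,1,1⟩,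
  ⟨5,15,1,1⟩, ⟨6,9,1,1⟩, ⟨7,12,1,1⟩, ⟨8,33,1,0⟩, ⟨9,32,1,0⟩, ⟨9,34,1,1⟩, ⟨10,16,1,1⟩, ⟨11,24,1,1⟩,
  ⟨11,38,1,0⟩, ⟨12,37,1,1⟩, ⟨13,38,1,1⟩, ⟨14,33,1,1⟩, ⟨15,35,1,1⟩, ⟨16,4,1,1⟩, ⟨16,21,1,0⟩,
  ⟨16,42,0,0⟩, ⟨17,47,0,0⟩, ⟨18,50,0,0⟩, ⟨19,7,0,0⟩, ⟨20,2,0,0⟩, ⟨21,48,0,0⟩, ⟨21,51,0,1⟩,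
  ⟨22,0,0,0⟩, ⟨22,3,0,1⟩, ⟨23,36,1,1⟩, ⟨23,49,0,1⟩, ⟨24,5,1,1⟩, ⟨25,1,0,1⟩, ⟨26,53,0,1⟩,
  ⟨27,6,0,1⟩, ⟨28,50,0,1⟩, ⟨29,2,0,1⟩, ⟨30,52,0,1⟩, ⟨31,4,0,1⟩, ⟨32,30,1,0⟩, ⟨32,46,0,0⟩,
  ⟨33,17,1,0⟩, ⟨33,23,1,1⟩, ⟨33,40,0,0⟩, ⟨33,43,0,1⟩, ⟨34,18,1,1⟩, ⟨34,41,0,1⟩, ⟨35,28,1,1⟩,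
  ⟨35,45,0,1⟩, ⟨36,39,1,1⟩, ⟨37,21,1,1⟩, ⟨37,42,0,1⟩, ⟨38,26,1,1⟩, ⟨38,44,0,1⟩, ⟨39,13,1,1⟩,
  ⟨40,31,0,0⟩, ⟨41,22,0,0⟩, ⟨42,19,0,0⟩, ⟨42,25,0,1⟩, ⟨43,20,0,1⟩, ⟨44,29,0,1⟩, ⟨45,22,0,1⟩,
  ⟨46,27,0,1⟩, ⟨47,35,0,1⟩, ⟨48,24,0,1⟩, ⟨48,38,0,0⟩, ⟨49,33,0,0⟩, ⟨50,32,0,0⟩, ⟨50,34,0,1⟩,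
  ⟨51,16,0,1⟩, ⟨52,37,0,1⟩, ⟨53,33,0,1⟩]
theorem cXBA {u w v} (h : RelW XB u w) (h' : RelW XA w v) :
    RelW XBA u v :=
  h.cert h' 64 2 [0, 65, 130, 195, 260, 325, 390, 455, 4128, 4176, 4257, 4322, 4387, 4517, 4582,
  8203, 8264, 8329, 8394, 8460, 8525, 8590, 8655, 12324, 16400, 16664, 20775, 24593, 24658, 24725,
  24791, 24858, 24988, 25054, 28712, 28777, 28842, 28907, 28972, 29101, 29166, 32787, 32852,
  32918, 32985, 33051, 33181, 33247, 36912, 36977, 37042, 37107, 37172, 37301, 37359]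
    (by decide +kernel)

theorem cXABABA {u w v} (h : RelW XABA u w) (h' : RelW XBA w v) :
    RelW [] u v :=
  h.cert h' 64 16 []
    (by decide +kernel)

def XBB : List Ed := [⟨0,4,1,0⟩, ⟨1,7,1,0⟩, ⟨2,20,1,0⟩, ⟨3,15,1,0⟩, ⟨4,1,1,0⟩, ⟨5,4,1,1⟩,
  ⟨6,22,1,0⟩, ⟨7,21,1,0⟩, ⟨8,0,1,0⟩, ⟨9,19,1,0⟩, ⟨9,24,0,0⟩, ⟨10,13,1,1⟩, ⟨11,25,0,0⟩, ⟨12,8,0,0⟩,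
  ⟨13,16,1,0⟩, ⟨14,6,1,0⟩, ⟨15,14,1,0⟩, ⟨15,17,1,1⟩, ⟨16,2,1,0⟩, ⟨17,0,1,1⟩, ⟨18,5,1,1⟩,
  ⟨19,18,1,1⟩, ⟨20,11,1,0⟩, ⟨21,3,1,0⟩, ⟨22,9,1,0⟩, ⟨22,10,1,1⟩, ⟨22,23,0,0⟩, ⟨23,12,0,0⟩,
  ⟨24,21,0,0⟩, ⟨25,4,0,0⟩]
theorem cXBB {u w v} (h : RelW XB u w) (h' : RelW XB w v) :
    RelW XBB u v :=
  h.cert h' 64 5 [65, 520, 4564, 4629, 4694, 8192, 8258, 8517, 8582, 8647, 12301, 12431, 12691,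
  16516, 20558, 20624, 20690, 20753, 24579, 24649, 24842, 25099, 28759, 33228, 36889, 37336]
    (by decide +kernel)

theorem cXBBB {u w v} (h : RelW XBB u w) (h' : RelW XB w v) :
    RelW [] u v :=
  h.cert h' 64 9 []
    (by decide +kernel)


end JR


namespace JR

/-! ### Event rows -/

/-- A loop: its length, its input events and its output events (position, type). -/
structure Lp (α : Type) where
  len : α
  ins : List (α × ℕ)
  outs : List (α × ℕ)

/-- The five loops with parameters `c`, `d`. -/
def loops {α : Type} [Add α] [Zero α] (c d : α) : List (Lp α) :=
  [⟨c + d, [(c, 2)], []⟩, ⟨c + d, [], [(0, 2)]⟩, ⟨c + d + d, [(c, 3)], []⟩,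
   ⟨c + d + d, [], [(d, 3)]⟩, ⟨c + d + (c + d), [(c + d, 2)], [(c, 2)]⟩]

/-- `E` is exactly the list of events of `f` on `[lo, hi)` (events outside being allowed). -/
def Ex (f : Wd) (lo hi : ℤ) (E : List (ℤ × ℕ)) : Prop :=
  (∀ q ∈ E, f q.1 = q.2) ∧ ∀ t, lo ≤ t → t < hi → f t ≠ 0 → (t, f t) ∈ E

def off (x : ℤ) (E : List (ℤ × ℕ)) : List (ℤ × ℕ) := E.map fun q => (x + q.1, q.2)

def Chain (P : List (Lp ℤ)) (S : Set ℤ) (I O : Wd) : Prop :=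
  (∀ N, ∃ x ∈ S, x ≤ N) ∧
  ∀ x ∈ S, ∃ k ∈ P, Ex I x (x + k.len) (off x k.ins) ∧ Ex O x (x + k.len) (off x k.outs) ∧
    x + k.len ∈ S

def Row (c d : ℤ) (I O : Wd) : Prop := ∃ S, Chain (loops c d) S I O

theorem Ex.shift {f lo hi E} (h : Ex f lo hi E) (k : ℤ) :
    Ex (sh k f) (lo - k) (hi - k) (off (-k) E) := by
  refine ⟨?_, ?_⟩
  · intro q hq
    obtain ⟨p, hp, rfl⟩ := List.mem_map.1 hq
    simpa [sh] using h.1 p hp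
  · intro t h1 h2 h3
    have := h.2 (t + k) (by omega) (by omega) h3
    exact List.mem_map.2 ⟨_, this, by simp [sh]⟩

theorem off_off (x y : ℤ) (E) : off x (off y E) = off (x + y) E := by
  simp [off, Function.comp_def, add_assoc]

theorem Row.shift {c d I O} (h : Row c d I O) (k : ℤ) : Row c d (sh k I) (sh k O) := by
  obtain ⟨S, h1, h2⟩ := h
  refine ⟨{x | x + k ∈ S}, fun N => ?_, fun x hx => ?_⟩
  · obtain ⟨x, hx, hN⟩ := h1 (N + k)
    exact ⟨x - k, by simpa using hx, by omega⟩
  · obtain ⟨p, hp, hi, ho, hn⟩ := h2 _ hx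
    refine ⟨p, hp, ?_, ?_, ?_⟩
    · have := hi.shift k
      rw [off_off] at this
      convert this using 1 <;> [ring; ring; (congr 1; ring)]
    · have := ho.shift k
      rw [off_off] at this
      convert this using 1 <;> [ring; ring; (congr 1; ring)]
    · simp only [Set.mem_ofPred_eq]
      convert hn using 1; ring

theorem Chain.cover {P S I O} (h : Chain P S I O) (hP : ∀ k ∈ P, 0 < k.len) (t : ℤ) :
    ∃ x ∈ S, ∃ k ∈ P, Ex I x (x + k.len) (off x k.ins) ∧ Ex O x (x + k.len) (off x k.outs) ∧
      x + k.len ∈ S ∧ x ≤ t ∧ t < x + k.len := by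
  obtain ⟨h1, h2⟩ := h
  have key : ∀ n : ℕ, ∀ x ∈ S, x ≤ t → t < x + n → ∃ x ∈ S, ∃ k ∈ P,
      Ex I x (x + k.len) (off x k.ins) ∧ Ex O x (x + k.len) (off x k.outs) ∧
      x + k.len ∈ S ∧ x ≤ t ∧ t < x + k.len := by
    intro n
    induction n with
    | zero => intro x _ h3 h4; simp at h4; omega
    | succ n ih =>
      intro x hx h3 h4
      obtain ⟨k, hk, hi, ho, hn⟩ := h2 x hx
      by_cases hlt : t < x + k.len
      · exact ⟨x, hx, k, hk, hi, ho, hn, h3, hlt⟩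
      · have := hP k hk
        exact ih _ hn (by omega) (by push_cast at h4; omega)
  obtain ⟨x, hx, hxt⟩ := h1 t
  exact key (t - x + 1).toNat x hx hxt (by omega)

/-! ### Symbolic exploration of three superposed rows

Positions are linear combinations `i * lam + j * mu` (relative to a base point), coded as pairs. -/

abbrev Ps := ℤ × ℤ

def ple (x y : Ps) : Bool := decide (x.1 ≤ y.1) && decide (x.2 ≤ y.2)
def plt (x y : Ps) : Bool := ple x y && !(decide (x = y))
def pne (x y : Ps) : Bool := !(decide (x = y)) && (ple x y || ple y x)
def num (x : Ps) : ℤ := 8 * x.1 + 5 * x.2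

/-- A partially known row: loops are known between `lo` and `p`. -/
structure SR where
  lo : Ps
  p : Ps
  ins : List (Ps × ℕ)
  outs : List (Ps × ℕ)

def psh (x : Ps) (E : List (Ps × ℕ)) : List (Ps × ℕ) := E.map fun q => (x + q.1, q.2)

def push (r : SR) (k : Lp Ps) : SR :=
  ⟨r.lo, r.p + k.len, psh r.p k.ins ++ r.ins, psh r.p k.outs ++ r.outs⟩

/-- Some event of `E` lies in the range `[lo, p)` and is not in `F`. -/
def bad1 (E : List (Ps × ℕ)) (lo p : Ps) (F : List (Ps × ℕ)) : Bool :=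
  E.any fun q => ple lo q.1 && plt q.1 p && F.all fun r => q.2 != r.2 || pne q.1 r.1

def bad2 (r r' : SR) : Bool := bad1 r.outs r'.lo r'.p r'.ins || bad1 r'.ins r.lo r.p r.outs

def badL : Option SR → SR → Bool
  | none, _ => false
  | some r, r' => bad2 r r'

def badU : SR → Option SR → Bool
  | _, none => false
  | r, some q => bad2 r q

/-- Which row to expand: `0` (lower), `1` (middle) or `2` (upper). -/
def pick : Option SR → SR → Option SR → ℕ
  | none, _, none => 1
  | some l, m, none => if num l.p ≤ num m.p then 0 else 1
  | none, m, some u => if num m.p ≤ num u.p then 1 else 2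
  | some l, m, some u =>
    if num l.p ≤ num m.p then if num l.p ≤ num u.p then 0 else 2
    else if num m.p ≤ num u.p then 1 else 2

def explore (P0 P1 P2 : List (Lp Ps)) (goal : Option SR → SR → Option SR → Bool) :
    ℕ → Option SR → SR → Option SR → Bool
  | 0, _, _, _ => false
  | n + 1, L, M, U =>
    badL L M || (badU M U || (goal L M U ||
      match U, M.outs with
      | none, q :: _ => P2.all fun k => k.ins.all fun s => s.2 != q.2 ||
          explore P0 P1 P2 goal n L M (some (push ⟨q.1 - s.1, q.1 - s.1, [], []⟩ k))
      | _, _ =>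
        match L, M.ins with
        | none, q :: _ => P0.all fun k => k.outs.all fun s => s.2 != q.2 ||
          explore P0 P1 P2 goal n (some (push ⟨q.1 - s.1, q.1 - s.1, [], []⟩ k)) M U
        | _, _ =>
          match pick L M U, L, U with
          | 0, some l, _ => P0.all fun k => explore P0 P1 P2 goal n (some (push l k)) M U
          | 2, _, some u => P2.all fun k => explore P0 P1 P2 goal n L M (some (push u k))
          | _, _, _ => P1.all fun k => explore P0 P1 P2 goal n L (push M k) U))

section sound

variable (x lam mu : ℤ)

def lin (p : Ps) : ℤ := p.1 * lam + p.2 * mu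

theorem lin_add (p q : Ps) : lin lam mu (p + q) = lin lam mu p + lin lam mu q := by
  simp [lin]; ring

theorem lin_sub (p q : Ps) : lin lam mu (p - q) = lin lam mu p - lin lam mu q := by
  simp [lin]; ring

theorem lin_zero : lin lam mu 0 = 0 := by simp [lin]

def evl (E : List (Ps × ℕ)) : List (ℤ × ℕ) := E.map fun q => (x + lin lam mu q.1, q.2)

def lpv (k : Lp Ps) : Lp ℤ := ⟨lin lam mu k.len, evl 0 lam mu k.ins, evl 0 lam mu k.outs⟩

theorem evl_psh (p : Ps) (E) : evl x lam mu (psh p E) = off (x + lin lam mu p) (evl 0 lam mu E) := by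
  simp [evl, psh, off, Function.comp_def, lin_add, add_assoc]

theorem evl_append (E F) : evl x lam mu (E ++ F) = evl x lam mu E ++ evl x lam mu F := by
  simp [evl]

variable {x lam mu}

theorem pos_of_pleN (hl : 0 < lam) (hm : 0 < mu) {p q : Ps} (h : ple p q = true) :
    lin lam mu p ≤ lin lam mu q := by
  simp only [ple, Bool.and_eq_true, decide_eq_true_eq] at h
  have h1 := mul_le_mul_of_nonneg_right h.1 hl.le
  have h2 := mul_le_mul_of_nonneg_right h.2 hm.le
  simp only [lin]; omega

theorem pos_of_plt (hl : 0 < lam) (hm : 0 < mu) {p q : Ps} (h : plt p q = true) :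
    lin lam mu p < lin lam mu q := by
  simp only [plt, ple, Bool.and_eq_true, decide_eq_true_eq, Bool.not_eq_true',
    decide_eq_false_iff_not] at h
  obtain ⟨⟨h1, h2⟩, h3⟩ := h
  have h3 : p.1 < q.1 ∨ p.2 < q.2 := by
    by_contra hc
    push Not at hc
    exact h3 (Prod.ext (by omega) (by omega))
  simp only [lin]
  rcases h3 with h3 | h3
  · have := mul_lt_mul_of_pos_right h3 hl
    have := mul_le_mul_of_nonneg_right h2 hm.le
    omega
  · have := mul_le_mul_of_nonneg_right h1 hl.le
    have := mul_lt_mul_of_pos_right h3 hm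
    omega

theorem pos_of_pne (hl : 0 < lam) (hm : 0 < mu) {p q : Ps} (h : pne p q = true) :
    lin lam mu p ≠ lin lam mu q := by
  simp only [pne, Bool.and_eq_true, Bool.or_eq_true] at h
  rcases h.2 with h2 | h2
  · exact (pos_of_plt hl hm (p := p) (q := q) (by simp only [plt, h2, Bool.true_and]; exact h.1)).ne
  · refine (pos_of_plt hl hm (p := q) (q := p) ?_).ne'
    simp only [plt, h2, Bool.true_and]
    rw [← h.1]; congr 2; exact propext eq_comm

/-- All event types are nonzero. -/
def nzE (E : List (Ps × ℕ)) : Prop := ∀ q ∈ E, q.2 ≠ 0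

/-- The meaning of a partially known row. -/
def Holds (x lam mu : ℤ) (S : Set ℤ) (I O : Wd) (r : SR) : Prop :=
  x + lin lam mu r.p ∈ S ∧
  Ex I (x + lin lam mu r.lo) (x + lin lam mu r.p) (evl x lam mu r.ins) ∧
  Ex O (x + lin lam mu r.lo) (x + lin lam mu r.p) (evl x lam mu r.outs) ∧
  nzE r.ins ∧ nzE r.outs

def HoldsO (x lam mu : ℤ) (S : Set ℤ) (I O : Wd) (r : Option SR) : Prop :=
  ∀ l, r = some l → Holds x lam mu S I O l

theorem Ex.append {f : Wd} {a b c : ℤ} {E F} (h : Ex f a b E) (h' : Ex f b c F) :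
    Ex f a c (F ++ E) := by
  refine ⟨fun q hq => ?_, fun t h1 h2 h3 => ?_⟩
  · rcases List.mem_append.1 hq with hq | hq
    · exact h'.1 q hq
    · exact h.1 q hq
  · rcases lt_or_ge t b with hb | hb
    · exact List.mem_append_right _ (h.2 t h1 hb h3)
    · exact List.mem_append_left _ (h'.2 t hb h2 h3)

theorem nzE_append {E F} (h : nzE E) (h' : nzE F) : nzE (E ++ F) := by
  intro q hq
  rcases List.mem_append.1 hq with hq | hq
  · exact h q hq
  · exact h' q hq

theorem nzE_psh {E} (p) (h : nzE E) : nzE (psh p E) := by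
  intro q hq
  obtain ⟨r, hr, rfl⟩ := List.mem_map.1 hq
  exact h r hr

theorem Holds.push {S : Set ℤ} {I O : Wd} {r : SR} {k : Lp Ps}
    (h : Holds x lam mu S I O r)
    (hi : Ex I (x + lin lam mu r.p) (x + lin lam mu r.p + (lpv lam mu k).len)
      (off (x + lin lam mu r.p) (lpv lam mu k).ins))
    (ho : Ex O (x + lin lam mu r.p) (x + lin lam mu r.p + (lpv lam mu k).len)
      (off (x + lin lam mu r.p) (lpv lam mu k).outs))
    (hn : x + lin lam mu r.p + (lpv lam mu k).len ∈ S)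
    (hz : nzE k.ins) (hz' : nzE k.outs) : Holds x lam mu S I O (push r k) := by
  obtain ⟨-, h1, h2, z1, z2⟩ := h
  have e : x + lin lam mu (r.p + k.len) = x + lin lam mu r.p + (lpv lam mu k).len := by
    rw [lin_add, add_assoc]; rfl
  refine ⟨?_, ?_, ?_, ?_, ?_⟩
  · simp only [JR.push, e]; exact hn
  · simp only [JR.push, e, evl_append, evl_psh]
    exact h1.append hi
  · simp only [JR.push, e, evl_append, evl_psh]
    exact h2.append ho
  · exact nzE_append (nzE_psh _ hz) z1
  · exact nzE_append (nzE_psh _ hz') z2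

theorem bad1_sound (hl : 0 < lam) (hm : 0 < mu) {f : Wd} {E F lo p}
    (hv : ∀ q ∈ E, f (x + lin lam mu q.1) = q.2 ∧ q.2 ≠ 0)
    (hF : Ex f (x + lin lam mu lo) (x + lin lam mu p) (evl x lam mu F)) :
    bad1 E lo p F = false := by
  by_contra hb
  simp only [Bool.not_eq_false, bad1, List.any_eq_true, Bool.and_eq_true, List.all_eq_true,
    Bool.or_eq_true, bne_iff_ne] at hb
  obtain ⟨q, hq, ⟨h1, h2⟩, h3⟩ := hb
  have h1 := pos_of_pleN hl hm h1
  have h2 := pos_of_plt hl hm h2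
  obtain ⟨e1, e2⟩ := hv q hq
  have := hF.2 (x + lin lam mu q.1) (by omega) (by omega) (by rw [e1]; exact e2)
  obtain ⟨r, hr, he⟩ := List.mem_map.1 this
  simp only [Prod.mk.injEq, e1] at he
  rcases h3 r hr with h | h
  · exact h he.2.symm
  · have := pos_of_pne hl hm h
    omega

theorem bad2_sound (hl : 0 < lam) (hm : 0 < mu) {S S' : Set ℤ} {I O O' : Wd} {r r' : SR}
    (h : Holds x lam mu S I O r) (h' : Holds x lam mu S' O O' r') : bad2 r r' = false := by
  simp only [bad2, Bool.or_eq_false_iff]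
  refine ⟨bad1_sound hl hm (fun q hq => ⟨?_, h.2.2.2.2 q hq⟩) h'.2.1,
    bad1_sound hl hm (fun q hq => ⟨?_, h'.2.2.2.1 q hq⟩) h.2.2.1⟩
  · exact h.2.2.1.1 (x + lin lam mu q.1, q.2) (List.mem_map.2 ⟨q, hq, rfl⟩)
  · exact h'.2.1.1 (x + lin lam mu q.1, q.2) (List.mem_map.2 ⟨q, hq, rfl⟩)

/-- A list of loops is good: positive lengths and nonzero event types. -/
def goodP (lam mu : ℤ) (P : List (Lp Ps)) : Prop :=
  ∀ k ∈ P, 0 < lin lam mu k.len ∧ nzE k.ins ∧ nzE k.outs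

theorem Holds.step {S : Set ℤ} {I O : Wd} {r : SR} {P : List (Lp Ps)} (hP : goodP lam mu P)
    (hS : Chain (P.map (lpv lam mu)) S I O) (h : Holds x lam mu S I O r) :
    ∃ k ∈ P, Holds x lam mu S I O (JR.push r k) := by
  obtain ⟨k, hk, hi, ho, hn⟩ := hS.2 _ h.1
  obtain ⟨k, hkP, rfl⟩ := List.mem_map.1 hk
  exact ⟨k, hkP, h.push hi ho hn (hP k hkP).2.1 (hP k hkP).2.2⟩

theorem Holds.start {S : Set ℤ} {I O : Wd} (p : Ps) (h : x + lin lam mu p ∈ S) :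
    Holds x lam mu S I O ⟨p, p, [], []⟩ := by
  refine ⟨h, ⟨by simp [evl], ?_⟩, ⟨by simp [evl], ?_⟩, by simp [nzE], by simp [nzE]⟩ <;>
  · intro t h1 h2; simp only at h1 h2; omega

theorem Chain.anchorI {S : Set ℤ} {I O : Wd} {P : List (Lp Ps)} (hP : goodP lam mu P)
    (hS : Chain (P.map (lpv lam mu)) S I O) {q : Ps × ℕ} (hq : I (x + lin lam mu q.1) = q.2)
    (hz : q.2 ≠ 0) :
    ∃ k ∈ P, ∃ s ∈ k.ins, s.2 = q.2 ∧
      Holds x lam mu S I O (JR.push ⟨q.1 - s.1, q.1 - s.1, [], []⟩ k) := by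
  obtain ⟨y, hy, k, hk, hi, ho, hn, h1, h2⟩ := hS.cover (by
    intro k hk; obtain ⟨k, hkP, rfl⟩ := List.mem_map.1 hk; exact (hP k hkP).1)
      (x + lin lam mu q.1)
  obtain ⟨k, hkP, rfl⟩ := List.mem_map.1 hk
  have hm := hi.2 _ h1 h2 (by rw [hq]; exact hz)
  obtain ⟨s', hs', he⟩ := List.mem_map.1 hm
  obtain ⟨s, hs, rfl⟩ := List.mem_map.1 hs'
  simp only [Prod.mk.injEq, hq] at he
  have e : x + lin lam mu (q.1 - s.1) = y := by rw [lin_sub]; omega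
  refine ⟨k, hkP, s, hs, he.2, Holds.push (.start _ (by rw [e]; exact hy)) ?_ ?_ ?_
    (hP k hkP).2.1 (hP k hkP).2.2⟩ <;> simp only [e] <;> assumption

theorem Chain.anchorO {S : Set ℤ} {I O : Wd} {P : List (Lp Ps)} (hP : goodP lam mu P)
    (hS : Chain (P.map (lpv lam mu)) S I O) {q : Ps × ℕ} (hq : O (x + lin lam mu q.1) = q.2)
    (hz : q.2 ≠ 0) :
    ∃ k ∈ P, ∃ s ∈ k.outs, s.2 = q.2 ∧
      Holds x lam mu S I O (JR.push ⟨q.1 - s.1, q.1 - s.1, [], []⟩ k) := by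
  obtain ⟨y, hy, k, hk, hi, ho, hn, h1, h2⟩ := hS.cover (by
    intro k hk; obtain ⟨k, hkP, rfl⟩ := List.mem_map.1 hk; exact (hP k hkP).1)
      (x + lin lam mu q.1)
  obtain ⟨k, hkP, rfl⟩ := List.mem_map.1 hk
  have hm := ho.2 _ h1 h2 (by rw [hq]; exact hz)
  obtain ⟨s', hs', he⟩ := List.mem_map.1 hm
  obtain ⟨s, hs, rfl⟩ := List.mem_map.1 hs'
  simp only [Prod.mk.injEq, hq] at he
  have e : x + lin lam mu (q.1 - s.1) = y := by rw [lin_sub]; omega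
  refine ⟨k, hkP, s, hs, he.2, Holds.push (.start _ (by rw [e]; exact hy)) ?_ ?_ ?_
    (hP k hkP).2.1 (hP k hkP).2.2⟩ <;> simp only [e] <;> assumption

theorem HoldsO.some {S : Set ℤ} {I O : Wd} {r : SR} (h : Holds x lam mu S I O r) :
    HoldsO x lam mu S I O (some r) := by
  rintro l ⟨⟩; exact h

theorem explore_sound (hl : 0 < lam) (hm : 0 < mu) {P0 P1 P2 : List (Lp Ps)}
    {goal : Option SR → SR → Option SR → Bool} {S0 S1 S2 : Set ℤ} {e0 e1 e2 e3 : Wd}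
    (g0 : goodP lam mu P0) (g1 : goodP lam mu P1) (g2 : goodP lam mu P2)
    (c0 : Chain (P0.map (lpv lam mu)) S0 e0 e1) (c1 : Chain (P1.map (lpv lam mu)) S1 e1 e2)
    (c2 : Chain (P2.map (lpv lam mu)) S2 e2 e3) :
    ∀ n L M U, explore P0 P1 P2 goal n L M U = true → HoldsO x lam mu S0 e0 e1 L →
      Holds x lam mu S1 e1 e2 M → HoldsO x lam mu S2 e2 e3 U →
      ∃ L' M' U', HoldsO x lam mu S0 e0 e1 L' ∧ Holds x lam mu S1 e1 e2 M' ∧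
        HoldsO x lam mu S2 e2 e3 U' ∧ goal L' M' U' = true := by
  intro n
  induction n with
  | zero => intro L M U h; simp [explore] at h
  | succ n ih =>
    intro L M U h hL hM hU
    have stepM : (P1.all fun k => explore P0 P1 P2 goal n L (push M k) U) = true →
        ∃ L' M' U', HoldsO x lam mu S0 e0 e1 L' ∧ Holds x lam mu S1 e1 e2 M' ∧
        HoldsO x lam mu S2 e2 e3 U' ∧ goal L' M' U' = true := by
      intro h
      obtain ⟨k, hk, hk'⟩ := hM.step g1 c1
      exact ih _ _ _ (List.all_eq_true.1 h k hk) hL hk' hU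
    unfold explore at h
    rw [Bool.or_eq_true] at h
    rcases h with h | h
    · exfalso
      cases L with
      | none => simp [badL] at h
      | some l => simp [badL, bad2_sound hl hm (hL l rfl) hM] at h
    rw [Bool.or_eq_true] at h
    rcases h with h | h
    · exfalso
      cases U with
      | none => simp [badU] at h
      | some u => simp [badU, bad2_sound hl hm hM (hU u rfl)] at h
    rw [Bool.or_eq_true] at h
    rcases h with h | h
    · exact ⟨L, M, U, hL, hM, hU, h⟩
    split at h
    · rename_i q qs heq
      have hq : q ∈ M.outs := by rw [heq]; simp
      obtain ⟨k, hk, s, hs, e, hh⟩ := c2.anchorI (x := x) g2 (q := q)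
        (hM.2.2.1.1 (x + lin lam mu q.1, q.2) (List.mem_map.2 ⟨q, hq, rfl⟩)) (hM.2.2.2.2 q hq)
      have h' := List.all_eq_true.1 (List.all_eq_true.1 h k hk) s hs
      simp only [e, bne_self_eq_false, Bool.false_or] at h'
      exact ih _ _ _ h' hL hM (.some hh)
    · split at h
      · rename_i q qs heq
        have hq : q ∈ M.ins := by rw [heq]; simp
        obtain ⟨k, hk, s, hs, e, hh⟩ := c0.anchorO (x := x) g0 (q := q)
          (hM.2.1.1 (x + lin lam mu q.1, q.2) (List.mem_map.2 ⟨q, hq, rfl⟩)) (hM.2.2.2.1 q hq)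
        have h' := List.all_eq_true.1 (List.all_eq_true.1 h k hk) s hs
        simp only [e, bne_self_eq_false, Bool.false_or] at h'
        exact ih _ _ _ h' (.some hh) hM hU
      · split at h
        · obtain ⟨k, hk, hk'⟩ := (hL _ rfl).step g0 c0
          exact ih _ _ _ (List.all_eq_true.1 h k hk) (.some hk') hM hU
        · obtain ⟨k, hk, hk'⟩ := (hU _ rfl).step g2 c2
          exact ih _ _ _ (List.all_eq_true.1 h k hk) hL hM (.some hk')
        · exact stepM h

end sound

/-! ### The three symbolic computations -/

def PC : Ps := (2, 1)
def PD : Ps := (3, 2)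

def PLU : List (Lp Ps) := loops PC PD
def PM : List (Lp Ps) := loops (1, 1) PC
def PN : List (Lp Ps) := loops (5, 3) (8, 5)

def syncB (L M U : SR) : Bool :=
  decide (L.p = U.p + PD) && decide (M.p = U.p + PC) && ple L.lo U.p && ple M.lo U.p &&
  L.ins.all (fun q => plt q.1 U.p) && L.outs.all (fun q => plt q.1 U.p) &&
  M.outs.all (fun q => plt q.1 U.p)

def goal1 : Option SR → SR → Option SR → Bool
  | some L, M, some U => syncB L M U && decide (L.lo = 0) && decide (U.lo = 0) &&
      PN.any fun k => decide (k.len = U.p) && decide (k.ins = L.ins) && decide (k.outs = U.outs)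
  | _, _, _ => false

def goal2 : Option SR → SR → Option SR → Bool
  | some L, M, some U => syncB L M U && ple U.p (29, 18)
  | _, _, _ => false

theorem comp1 : explore PLU PM PLU goal1 20 (some ⟨0, PD, [], []⟩) ⟨0, PC, [], []⟩
    (some ⟨0, 0, [], []⟩) = true := by decide +kernel

theorem comp2 : explore PLU PM PLU goal2 20 none ⟨0, 0, [], []⟩ none = true := by decide +kernel

theorem comp3 : explore PN PM PLU (fun _ _ _ => false) 20 none ⟨0, 0, [], []⟩ none = true := by
  decide +kernel

end JR


namespace JR

theorem loops_map (lam mu : ℤ) (p q : Ps) :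
    (loops p q).map (lpv lam mu) = loops (lin lam mu p) (lin lam mu q) := by
  simp [loops, lpv, evl, lin_add, lin_zero]

theorem good_loops {lam mu : ℤ} {p q : Ps} (hp : 0 < lin lam mu p) (hq : 0 < lin lam mu q) :
    goodP lam mu (loops p q) := by
  intro k hk
  simp only [loops, List.mem_cons, List.not_mem_nil, or_false] at hk
  rcases hk with rfl | rfl | rfl | rfl | rfl <;> simp only [lin_add] <;>
    refine ⟨by omega, ?_, ?_⟩ <;> simp [nzE]

section
variable {lam mu : ℤ} {e0 e1 e2 e3 : Wd}

theorem nil_of_plt {x s : ℤ} {p lo hi : Ps} {f : Wd} {E : List (Ps × ℕ)}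
    (hl : 0 < lam) (hm : 0 < mu)
    (h : Ex f (x + lin lam mu lo) (x + lin lam mu hi) (evl x lam mu E))
    (hE : E.all (fun q => plt q.1 p) = true) (hlo : ple lo p = true)
    (hs : s ≤ x + lin lam mu hi) : Ex f (x + lin lam mu p) s [] := by
  refine ⟨by simp, fun t h1 h2 h3 => ?_⟩
  have h4 := pos_of_pleN hl hm hlo
  have := h.2 t (by omega) (by omega) h3
  obtain ⟨q, hq, he⟩ := List.mem_map.1 this
  have h5 := pos_of_plt hl hm (List.all_eq_true.1 hE q hq)
  simp only [Prod.mk.injEq] at he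
  omega

/-- The synchronisation points of three superposed rows. -/
def Sync (lam mu : ℤ) (SL SM SU : Set ℤ) (e0 e1 e2 : Wd) (x : ℤ) : Prop :=
  x + lin lam mu PD ∈ SL ∧ x + lin lam mu PC ∈ SM ∧ x ∈ SU ∧
  Ex e0 x (x + lin lam mu PD) [] ∧ Ex e1 x (x + lin lam mu PD) [] ∧
  Ex e2 x (x + lin lam mu PC) []

theorem sync_of {x : ℤ} (hl : 0 < lam) (hm : 0 < mu) {SL SM SU : Set ℤ} {L M U : SR}
    (hL : Holds x lam mu SL e0 e1 L) (hM : Holds x lam mu SM e1 e2 M)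
    (hU : Holds x lam mu SU e2 e3 U) (h : syncB L M U = true) :
    Sync lam mu SL SM SU e0 e1 e2 (x + lin lam mu U.p) := by
  simp only [syncB, Bool.and_eq_true, decide_eq_true_eq] at h
  obtain ⟨⟨⟨⟨⟨⟨h1, h2⟩, h3⟩, h4⟩, h5⟩, h6⟩, h7⟩ := h
  have eL : x + lin lam mu L.p = x + lin lam mu U.p + lin lam mu PD := by
    rw [h1, lin_add]; ring
  have eM : x + lin lam mu M.p = x + lin lam mu U.p + lin lam mu PC := by
    rw [h2, lin_add]; ring
  refine ⟨?_, ?_, hU.1, ?_, ?_, ?_⟩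
  · rw [← eL]; exact hL.1
  · rw [← eM]; exact hM.1
  · exact nil_of_plt hl hm hL.2.1 h5 h3 eL.ge
  · exact nil_of_plt hl hm hL.2.2.1 h6 h3 eL.ge
  · exact nil_of_plt hl hm hM.2.2.1 h7 h4 eM.ge

/-- The renormalisation step. -/
theorem rowR (hl : 0 < lam) (hm : 0 < mu)
    (hL : Row (2 * lam + mu) (3 * lam + 2 * mu) e0 e1)
    (hM : Row (lam + mu) (2 * lam + mu) e1 e2)
    (hU : Row (2 * lam + mu) (3 * lam + 2 * mu) e2 e3) :
    Row (5 * lam + 3 * mu) (8 * lam + 5 * mu) e0 e3 := by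
  have lC : lin lam mu PC = 2 * lam + mu := by simp [lin, PC]
  have lD : lin lam mu PD = 3 * lam + 2 * mu := by simp [lin, PD]
  have l1 : lin lam mu (1, 1) = lam + mu := by simp [lin]
  have l5 : lin lam mu (5, 3) = 5 * lam + 3 * mu := by simp [lin]
  have l8 : lin lam mu (8, 5) = 8 * lam + 5 * mu := by simp [lin]
  rw [← lC, ← lD] at hL hU
  rw [← lC, ← l1] at hM
  rw [← l5, ← l8]
  have gLU : goodP lam mu PLU := good_loops (by omega) (by omega)
  have gM : goodP lam mu PM := good_loops (by omega) (by omega)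
  obtain ⟨SL, hL⟩ := hL
  obtain ⟨SM, hM⟩ := hM
  obtain ⟨SU, hU⟩ := hU
  rw [← loops_map] at hL hM hU
  unfold Row
  rw [← loops_map]
  refine ⟨{x | Sync lam mu SL SM SU e0 e1 e2 x}, fun N => ?_, fun x hx => ?_⟩
  · obtain ⟨x, hx, hxN⟩ := hM.1 (N - lin lam mu (29, 18))
    obtain ⟨L, M, U, kL, kM, kU, hg⟩ := explore_sound (x := x) hl hm gLU gM gLU hL hM hU 20 none
      ⟨0, 0, [], []⟩ none comp2 (by simp [HoldsO]) (.start 0 (by simpa [lin_zero] using hx))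
      (by simp [HoldsO])
    rcases L with _ | L <;> rcases U with _ | U <;> simp only [goal2, Bool.false_eq_true] at hg
    rw [Bool.and_eq_true] at hg
    refine ⟨_, sync_of hl hm (kL L rfl) kM (kU U rfl) hg.1, ?_⟩
    have := pos_of_pleN hl hm hg.2
    omega
  · obtain ⟨h1, h2, h3, h4, h5, h6⟩ := hx
    have hCD : lin lam mu PC ≤ lin lam mu PD := by omega
    have hL0 : Holds x lam mu SL e0 e1 ⟨0, PD, [], []⟩ := by
      refine ⟨h1, ?_, ?_, by simp [nzE], by simp [nzE]⟩ <;> simpa [evl, lin_zero]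
    have hM0 : Holds x lam mu SM e1 e2 ⟨0, PC, [], []⟩ := by
      refine ⟨h2, ?_, ?_, by simp [nzE], by simp [nzE]⟩
      · refine ⟨by simp [evl], fun t k1 k2 k3 => ?_⟩
        simp only [lin_zero, add_zero] at k1
        exact absurd (h5.2 t k1 (by simp only at k2; omega) k3) (by simp)
      · simpa [evl, lin_zero]
    have hU0 : Holds x lam mu SU e2 e3 ⟨0, 0, [], []⟩ := .start 0 (by simpa [lin_zero] using h3)
    obtain ⟨L, M, U, kL, kM, kU, hg⟩ := explore_sound (x := x) hl hm gLU gM gLU hL hM hU 20 _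
      _ _ comp1 (.some hL0) hM0 (.some hU0)
    rcases L with _ | L <;> rcases U with _ | U <;> simp only [goal1, Bool.false_eq_true] at hg
    simp only [Bool.and_eq_true, List.any_eq_true, decide_eq_true_eq] at hg
    obtain ⟨⟨⟨hs, gL⟩, gU⟩, k, hk, ⟨gp, gi⟩, go⟩ := hg
    have hsy := sync_of hl hm (kL L rfl) kM (kU U rfl) hs
    have hLL := (kL L rfl).2.1
    have hUU := (kU U rfl).2.2.1
    have ei : evl x lam mu L.ins = off x (lpv lam mu k).ins := by
      rw [← gi]; simp [evl, off, lpv, Function.comp_def]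
    have eo : evl x lam mu U.outs = off x (lpv lam mu k).outs := by
      rw [← go]; simp [evl, off, lpv, Function.comp_def]
    have ep : x + lin lam mu U.p = x + (lpv lam mu k).len := by rw [← gp]; rfl
    rw [gL, ei, lin_zero, add_zero] at hLL
    rw [gU, eo, lin_zero, add_zero, ep] at hUU
    refine ⟨lpv lam mu k, List.mem_map.2 ⟨k, hk, rfl⟩, ?_, hUU, ?_⟩
    · refine ⟨hLL.1, fun t k1 k2 k3 => hLL.2 t k1 ?_ k3⟩
      simp only [syncB, Bool.and_eq_true, decide_eq_true_eq] at hs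
      have := hs.1.1.1.1.1.1
      rw [this, lin_add]
      omega
    · rw [← ep]; exact hsy

theorem rowE (hl : 0 < lam) (hm : 0 < mu)
    (hL : Row (5 * lam + 3 * mu) (8 * lam + 5 * mu) e0 e1)
    (hM : Row (lam + mu) (2 * lam + mu) e1 e2)
    (hU : Row (2 * lam + mu) (3 * lam + 2 * mu) e2 e3) : False := by
  have lC : lin lam mu PC = 2 * lam + mu := by simp [lin, PC]
  have lD : lin lam mu PD = 3 * lam + 2 * mu := by simp [lin, PD]
  have l1 : lin lam mu (1, 1) = lam + mu := by simp [lin]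
  have l5 : lin lam mu (5, 3) = 5 * lam + 3 * mu := by simp [lin]
  have l8 : lin lam mu (8, 5) = 8 * lam + 5 * mu := by simp [lin]
  rw [← lC, ← lD] at hU
  rw [← lC, ← l1] at hM
  rw [← l5, ← l8] at hL
  have gLU : goodP lam mu PLU := good_loops (by omega) (by omega)
  have gM : goodP lam mu PM := good_loops (by omega) (by omega)
  have gN : goodP lam mu PN := good_loops (by omega) (by omega)
  obtain ⟨SL, hL⟩ := hL
  obtain ⟨SM, hM⟩ := hM
  obtain ⟨SU, hU⟩ := hU
  rw [← loops_map] at hL hM hU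
  obtain ⟨x, hx, -⟩ := hM.1 0
  obtain ⟨L, M, U, -, -, -, hg⟩ := explore_sound (x := x) hl hm gN gM gLU hL hM hU 20 none
      ⟨0, 0, [], []⟩ none comp3 (by simp [HoldsO]) (.start 0 (by simpa [lin_zero] using hx))
      (by simp [HoldsO])
  simp at hg

end

end JR


namespace JR

/-! ### From transducers to event rows -/

/-- Transducer reading windows that are one letter longer. -/
def ext (X : List Ed) : List Ed :=
  X.flatMap fun a => (X.filter fun b => a.e == b.w).map fun b =>
    ⟨X.idxOf a, X.idxOf b, a.s * 2 + b.s % 2, a.n * 2 + b.n % 2⟩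

def extW (u : Wd) : Wd := fun t => u t * 2 + u (t + 1) % 2

theorem RelW.ext {X u v} (h : RelW X u v) : RelW (ext X) (extW u) (extW v) := by
  obtain ⟨r, hr, hu, hv⟩ := h
  refine ⟨fun t => ⟨X.idxOf (r t), X.idxOf (r (t + 1)), (r t).s * 2 + (r (t + 1)).s % 2,
    (r t).n * 2 + (r (t + 1)).n % 2⟩, fun t => ⟨?_, rfl⟩, fun t => ?_, fun t => ?_⟩
  · simp only [JR.ext, List.mem_flatMap, List.mem_map, List.mem_filter, beq_iff_eq]
    exact ⟨r t, (hr t).1, r (t + 1), ⟨(hr _).1, (hr t).2⟩, rfl⟩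
  · simp [extW, hu]
  · simp [extW, hv]

def filt (f g : ℕ → Bool) (X : List Ed) : List Ed := X.filter fun a => f a.s && g a.n

theorem RelW.filt {X u v} (h : RelW X u v) {f g : ℕ → Bool} (hf : ∀ t, f (u t) = true)
    (hg : ∀ t, g (v t) = true) : RelW (filt f g X) u v := by
  obtain ⟨r, hr, hu, hv⟩ := h
  refine ⟨r, fun t => ⟨?_, (hr t).2⟩, hu, hv⟩
  simp only [JR.filt, List.mem_filter, Bool.and_eq_true]
  exact ⟨(hr t).1, by rw [← hu]; exact hf t, by rw [← hv]; exact hg t⟩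

def lab (f g : ℕ → ℕ) (X : List Ed) : List Ed := X.map fun a => ⟨a.w, a.e, f a.s, g a.n⟩

theorem RelW.lab {X u v} (h : RelW X u v) (f g : ℕ → ℕ) :
    RelW (lab f g X) (fun t => f (u t)) (fun t => g (v t)) := by
  obtain ⟨r, hr, hu, hv⟩ := h
  refine ⟨fun t => ⟨(r t).w, (r t).e, f (r t).s, g (r t).n⟩, fun t => ⟨?_, (hr t).2⟩,
    fun t => by simp [hu], fun t => by simp [hv]⟩
  exact List.mem_map.2 ⟨r t, (hr t).1, rfl⟩

/-- Words of a loop. -/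
def evAt (E : List (ℤ × ℕ)) (i : ℕ) : ℕ := ((E.find? fun q => q.1 == (i : ℤ)).map (·.2)).getD 0

def wordOf (k : Lp ℤ) : List (ℕ × ℕ) :=
  (List.range k.len.toNat).map fun i => (evAt k.ins i, evAt k.outs i)

def okE (len : ℤ) (E : List (ℤ × ℕ)) : Bool :=
  E.all fun q => decide (0 ≤ q.1) && decide (q.1 < len) && decide (evAt E q.1.toNat = q.2)

def MatchW (r : ℤ → Ed) (t : ℤ) : List (ℕ × ℕ) → Prop
  | [] => True
  | x :: l => (r t).s = x.1 ∧ (r t).n = x.2 ∧ MatchW r (t + 1) l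

theorem MatchW.get {r : ℤ → Ed} : ∀ {l : List (ℕ × ℕ)} {t : ℤ}, MatchW r t l →
    ∀ i (hi : i < l.length), (r (t + i)).s = l[i].1 ∧ (r (t + i)).n = l[i].2
  | [], _, _, i, hi => by simp at hi
  | x :: l, t, h, 0, hi => by simpa using ⟨h.1, h.2.1⟩
  | x :: l, t, h, i + 1, hi => by
    have := MatchW.get h.2.2 i (by simpa using hi)
    rw [show t + ((i + 1 : ℕ) : ℤ) = t + 1 + i by push_cast; ring]
    simpa using this

theorem evAt_mem {E : List (ℤ × ℕ)} {i : ℕ} (h : evAt E i ≠ 0) : ((i : ℤ), evAt E i) ∈ E := by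
  unfold evAt at h ⊢
  rcases hf : E.find? (fun q => q.1 == (i : ℤ)) with _ | q
  · simp [hf] at h
  · have h1 := List.mem_of_find?_eq_some hf
    have h2 := List.find?_some hf
    simp only [beq_iff_eq] at h2
    rw [hf, ← h2]; exact h1

theorem ex_of_word {f : Wd} {t len : ℤ} {E : List (ℤ × ℕ)} (hE : okE len E = true)
    (h : ∀ i : ℕ, (i : ℤ) < len → f (t + i) = evAt E i) : Ex f t (t + len) (off t E) := by
  refine ⟨fun q hq => ?_, fun s h1 h2 h3 => ?_⟩
  · obtain ⟨p, hp, rfl⟩ := List.mem_map.1 hq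
    have := List.all_eq_true.1 hE p hp
    simp only [Bool.and_eq_true, decide_eq_true_eq] at this
    obtain ⟨⟨a, b⟩, c⟩ := this
    have := h p.1.toNat (by omega)
    rw [c, Int.toNat_of_nonneg a] at this
    exact this
  · have := h (s - t).toNat (by omega)
    rw [Int.toNat_of_nonneg (by omega), add_sub_cancel] at this
    rw [this] at h3 ⊢
    have := evAt_mem h3
    rw [Int.toNat_of_nonneg (by omega)] at this
    exact List.mem_map.2 ⟨_, this, by simp⟩

def adv (a : Ed) (cs : List (List (ℕ × ℕ))) : List (List (ℕ × ℕ)) :=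
  cs.filterMap fun c => match c with
    | [] => none
    | x :: l => if a.s == x.1 && a.n == x.2 then some l else none

def dfs (Z : List Ed) (y : ℕ) : ℕ → ℕ → List (List (ℕ × ℕ)) → Bool
  | 0, _, _ => false
  | n + 1, s, cs => (cs.any (fun c => c.isEmpty) && s == y) ||
      Z.all fun a => a.w != s || dfs Z y n a.e (adv a cs)

theorem dfs_sound {Z r y} (hr : IsRow Z r) : ∀ n cs t, dfs Z y n (r t).w cs = true →
    ∃ l ∈ cs, MatchW r t l ∧ (r (t + l.length)).w = y := by
  intro n
  induction n with
  | zero => intro cs t h; simp [dfs] at h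
  | succ n ih =>
    intro cs t h
    rw [dfs, Bool.or_eq_true] at h
    rcases h with h | h
    · simp only [Bool.and_eq_true, List.any_eq_true, List.isEmpty_iff, beq_iff_eq] at h
      obtain ⟨⟨l, hl, rfl⟩, hs⟩ := h
      exact ⟨[], hl, trivial, by simpa using hs⟩
    · have := List.all_eq_true.1 h (r t) (hr t).1
      simp only [bne_self_eq_false, Bool.false_or, (hr t).2] at this
      obtain ⟨l, hl, hm, hy⟩ := ih _ _ this
      simp only [adv, List.mem_filterMap] at hl
      obtain ⟨c, hc, hcl⟩ := hl
      rcases c with _ | ⟨x, c⟩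
      · simp at hcl
      · simp only [Option.ite_none_right_eq_some, Bool.and_eq_true, beq_iff_eq,
          Option.some.injEq] at hcl
        obtain ⟨⟨h1, h2⟩, rfl⟩ := hcl
        refine ⟨x :: c, hc, ⟨h1, h2, hm⟩, ?_⟩
        rw [← hy]; congr 2
        simp; ring

def reach (Z : List Ed) (y : ℕ) : ℕ → ℕ → Bool
  | 0, s => s == y
  | n + 1, s => s == y || Z.all fun a => a.w != s || reach Z y n a.e

theorem reach_sound {Z r y} (hr : IsRow Z r) : ∀ n t, reach Z y n (r t).w = true →
    ∃ t' ≤ t + n, (r t').w = y := by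
  intro n
  induction n with
  | zero => intro t h; exact ⟨t, by simp, by simpa [reach] using h⟩
  | succ n ih =>
    intro t h
    rw [reach, Bool.or_eq_true] at h
    rcases h with h | h
    · exact ⟨t, by omega, by simpa using h⟩
    · have := List.all_eq_true.1 h (r t) (hr t).1
      simp only [bne_self_eq_false, Bool.false_or, (hr t).2] at this
      obtain ⟨t', h1, h2⟩ := ih _ this
      exact ⟨t', by push_cast; omega, h2⟩

theorem row_of_relW {Z I O} (h : RelW Z I O) (c d : ℤ) (y n m : ℕ)
    (h1 : dfs Z y n y ((loops c d).map wordOf) = true)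
    (h2 : (Z.all fun a => reach Z y m a.w) = true)
    (h3 : ((loops c d).all fun k => decide (0 ≤ k.len) && okE k.len k.ins && okE k.len k.outs)
      = true) : Row c d I O := by
  obtain ⟨r, hr, hI, hO⟩ := h
  refine ⟨{t | (r t).w = y}, fun N => ?_, fun x hx => ?_⟩
  · obtain ⟨t, ht, hy⟩ := reach_sound hr m (N - m) (List.all_eq_true.1 h2 _ (hr _).1)
    exact ⟨t, hy, by omega⟩
  · have hx : (r x).w = y := hx
    obtain ⟨l, hl, hm, hy⟩ := dfs_sound (y := y) hr n _ x (by rw [hx]; exact h1)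
    obtain ⟨k, hk, rfl⟩ := List.mem_map.1 hl
    have h4 := List.all_eq_true.1 h3 k hk
    simp only [Bool.and_eq_true, decide_eq_true_eq] at h4
    have e : ((wordOf k).length : ℤ) = k.len := by
      simp only [wordOf, List.length_map, List.length_range]; omega
    rw [e] at hy
    refine ⟨k, hk, ex_of_word h4.1.2 fun i hi => ?_, ex_of_word h4.2 fun i hi => ?_, hy⟩
    · have := (hm.get i (by omega)).1
      rw [hI, this]; simp [wordOf]
    · have := (hm.get i (by omega)).2
      rw [hO, this]; simp [wordOf]

/-! ### Decoding of words into events -/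

def dec1 (a b c d : ℕ) : ℕ :=
  if b == 1 && c == 1 && d == 1 then 3
  else if a == 0 && b == 1 && c == 1 && d == 0 then 2 else 0

def dec0 (a b c d : ℕ) : ℕ :=
  if a == 0 && b == 0 && c == 0 then 3
  else if a == 1 && b == 0 && c == 0 && d == 1 then 2 else 0

def bg0 (a b c d : ℕ) : Bool :=
  decide (a < 2) && !(a == 1 && b == 1 && c == 1 && d == 1) && !(a == 0 && b == 1 && c == 0)
  && !(b == 0 && c == 1 && d == 0)

def bg1 (a b c d : ℕ) : Bool :=
  decide (a < 2) && !(a == 0 && b == 0 && c == 0 && d == 0) && !(a == 1 && b == 0 && c == 1)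
  && !(b == 1 && c == 0 && d == 1)

def D0 (w : Wd) : Wd := fun t => dec0 (w (t - 1)) (w t) (w (t + 1)) (w (t + 2))
def D1 (w : Wd) : Wd := fun t => dec1 (w (t - 1)) (w t) (w (t + 1)) (w (t + 2))
def Bg0 (w : Wd) : Prop := ∀ t, bg0 (w t) (w (t + 1)) (w (t + 2)) (w (t + 3)) = true
def Bg1 (w : Wd) : Prop := ∀ t, bg1 (w t) (w (t + 1)) (w (t + 2)) (w (t + 3)) = true

theorem Bg0.shift {w} (h : Bg0 w) (k : ℤ) : Bg0 (sh k w) := by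
  intro t
  have := h (t + k)
  simp only [sh]
  rw [show t + 1 + k = t + k + 1 by ring, show t + 2 + k = t + k + 2 by ring,
    show t + 3 + k = t + k + 3 by ring]
  exact this

theorem Bg1.shift {w} (h : Bg1 w) (k : ℤ) : Bg1 (sh k w) := by
  intro t
  have := h (t + k)
  simp only [sh]
  rw [show t + 1 + k = t + k + 1 by ring, show t + 2 + k = t + k + 2 by ring,
    show t + 3 + k = t + k + 3 by ring]
  exact this

theorem D0_shift (w) (k : ℤ) : D0 (sh k w) = sh k (D0 w) := by
  funext t
  simp only [D0, sh]
  rw [show t - 1 + k = t + k - 1 by ring, show t + 1 + k = t + k + 1 by ring,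
    show t + 2 + k = t + k + 2 by ring]

theorem D1_shift (w) (k : ℤ) : D1 (sh k w) = sh k (D1 w) := by
  funext t
  simp only [D1, sh]
  rw [show t - 1 + k = t + k - 1 by ring, show t + 1 + k = t + k + 1 by ring,
    show t + 2 + k = t + k + 2 by ring]

/-- Functions of the first / last four letters of a window of five letters. -/
def fst4 {α : Type} (f : ℕ → ℕ → ℕ → ℕ → α) (m : ℕ) : α :=
  f (m / 16) (m / 8 % 2) (m / 4 % 2) (m / 2 % 2)
def lst4 {α : Type} (f : ℕ → ℕ → ℕ → ℕ → α) (m : ℕ) : α :=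
  f (m / 8 % 2) (m / 4 % 2) (m / 2 % 2) (m % 2)

def win (u : Wd) : Wd := extW (extW (extW (extW u)))

theorem win_eq {u : Wd} (hu : ∀ t, u t < 2) (t : ℤ) :
    win u t = 16 * u t + 8 * u (t + 1) + 4 * u (t + 2) + 2 * u (t + 3) + u (t + 4) := by
  have h1 := hu (t + 1)
  have h2 := hu (t + 2)
  have h3 := hu (t + 3)
  have h4 := hu (t + 4)
  simp only [win, extW]
  rw [show t + 1 + 1 = t + 2 by ring, show t + 2 + 1 = t + 3 by ring,
    show t + 3 + 1 = t + 4 by ring]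
  omega

theorem fst4_win {α : Type} (f : ℕ → ℕ → ℕ → ℕ → α) {u : Wd} (hu : ∀ t, u t < 2) (t : ℤ) :
    fst4 f (win u t) = f (u t) (u (t + 1)) (u (t + 2)) (u (t + 3)) := by
  have h0 := hu t
  have h1 := hu (t + 1)
  have h2 := hu (t + 2)
  have h3 := hu (t + 3)
  have h4 := hu (t + 4)
  rw [win_eq hu, fst4]
  congr 1 <;> omega

theorem lst4_win {α : Type} (f : ℕ → ℕ → ℕ → ℕ → α) {u : Wd} (hu : ∀ t, u t < 2) (t : ℤ) :
    lst4 f (win u t) = f (u (t + 1)) (u (t + 2)) (u (t + 3)) (u (t + 4)) := by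
  have h0 := hu t
  have h1 := hu (t + 1)
  have h2 := hu (t + 2)
  have h3 := hu (t + 3)
  have h4 := hu (t + 4)
  rw [win_eq hu, lst4]
  congr 1 <;> omega

theorem RelW.win {X u v} (h : RelW X u v) :
    RelW (JR.ext (JR.ext (JR.ext (JR.ext X)))) (win u) (win v) := h.ext.ext.ext.ext

theorem Bg0.lt {w} (h : Bg0 w) (t : ℤ) : w t < 2 := by
  have := h t; simp only [bg0, Bool.and_eq_true, decide_eq_true_eq] at this; exact this.1.1.1

theorem Bg1.lt {w} (h : Bg1 w) (t : ℤ) : w t < 2 := by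
  have := h t; simp only [bg1, Bool.and_eq_true, decide_eq_true_eq] at this; exact this.1.1.1

/-- Odd rows. -/
theorem row_odd {X Z u v} (h : RelW X u v) (hu : Bg0 u) (hv : Bg1 v) (c d : ℤ) (k : ℕ)
    (L : List ℕ) (y n m : ℕ)
    (h0 : JR.sub (JR.ren (look L) (JR.trim k (JR.lab (fst4 dec1) (lst4 dec0)
      (JR.filt (fun m => fst4 bg0 m && lst4 bg0 m) (fun m => fst4 bg1 m && lst4 bg1 m)
      (JR.ext (JR.ext (JR.ext (JR.ext X)))))))) Z = true)
    (h1 : dfs Z y n y ((loops c d).map wordOf) = true)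
    (h2 : (Z.all fun a => reach Z y m a.w) = true)
    (h3 : ((loops c d).all fun k => decide (0 ≤ k.len) && okE k.len k.ins && okE k.len k.outs)
      = true) : Row c d (sh (-1) (D1 u)) (D0 v) := by
  have hw := (((((h.win).filt (f := fun m => fst4 bg0 m && lst4 bg0 m)
    (g := fun m => fst4 bg1 m && lst4 bg1 m) (fun t => by
      rw [fst4_win _ hu.lt, lst4_win _ hu.lt, hu t]
      have := hu (t + 1)
      rw [show t + 1 + 1 = t + 2 by ring, show t + 1 + 2 = t + 3 by ring,
        show t + 1 + 3 = t + 4 by ring] at this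
      rw [this]; rfl) (fun t => by
      rw [fst4_win _ hv.lt, lst4_win _ hv.lt, hv t]
      have := hv (t + 1)
      rw [show t + 1 + 1 = t + 2 by ring, show t + 1 + 2 = t + 3 by ring,
        show t + 1 + 3 = t + 4 by ring] at this
      rw [this]; rfl)).lab (fst4 dec1) (lst4 dec0)).trim k).ren (look L)).sub h0
  have hr := (row_of_relW hw c d y n m h1 h2 h3).shift (-2)
  convert hr using 1
  · funext t
    simp only [sh, D1, fst4_win _ hu.lt]
    congr 2 <;> ring
  · funext t
    simp only [sh, D0, lst4_win _ hv.lt]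
    congr 2 <;> ring

/-- Even rows. -/
theorem row_even {X Z u v} (h : RelW X u v) (hu : ∀ t, u t < 2) (hv : ∀ t, v t < 2) (c d : ℤ)
    (k : ℕ) (L : List ℕ) (y n m : ℕ)
    (h0 : JR.sub (JR.ren (look L) (JR.trim k (JR.lab (lst4 dec0) (fst4 dec1)
      (JR.ext (JR.ext (JR.ext (JR.ext X))))))) Z = true)
    (h1 : dfs Z y n y ((loops c d).map wordOf) = true)
    (h2 : (Z.all fun a => reach Z y m a.w) = true)
    (h3 : ((loops c d).all fun k => decide (0 ≤ k.len) && okE k.len k.ins && okE k.len k.outs)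
      = true) : Row c d (sh 1 (D0 u)) (D1 v) := by
  have hw := ((((h.win).lab (lst4 dec0) (fst4 dec1)).trim k).ren (look L)).sub h0
  have hr := (row_of_relW hw c d y n m h1 h2 h3).shift (-1)
  convert hr using 1
  · funext t
    simp only [sh, D0, lst4_win _ hu]
    congr 2 <;> ring
  · funext t
    simp only [sh, D1, fst4_win _ hv]
    congr 2 <;> ring

theorem bg_of {X u v} (h : RelW X u v) (hu : ∀ t, u t < 2) (hv : ∀ t, v t < 2)
    (hX : ((JR.ext (JR.ext (JR.ext (JR.ext X)))).all fun a => fst4 bg1 a.s && fst4 bg0 a.n) = true) :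
    Bg1 u ∧ Bg0 v := by
  obtain ⟨r, hr, h1, h2⟩ := h.win
  refine ⟨fun t => ?_, fun t => ?_⟩
  · have := List.all_eq_true.1 hX _ (hr t).1
    rw [← h1, ← h2, Bool.and_eq_true, fst4_win _ hu] at this
    exact this.1
  · have := List.all_eq_true.1 hX _ (hr t).1
    rw [← h1, ← h2, Bool.and_eq_true, fst4_win _ hv] at this
    exact this.2

def EA : List Ed := [⟨0,5,0,0⟩, ⟨1,10,0,0⟩, ⟨2,1,0,0⟩, ⟨3,4,0,0⟩, ⟨4,0,2,0⟩, ⟨5,2,0,0⟩, ⟨6,2,2,0⟩,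
  ⟨6,7,3,0⟩, ⟨6,8,0,2⟩, ⟨6,9,0,0⟩, ⟨7,0,0,0⟩, ⟨8,3,0,0⟩, ⟨9,0,0,3⟩, ⟨10,0,0,2⟩, ⟨10,11,0,0⟩,
  ⟨11,6,0,0⟩]
def LA : List ℕ := [0, 65, 129, 258, 323, 448, 708, 901, 966, 1030, 1158, 1287, 1346, 1544, 1609,
  1861, 1994, 2058, 2122, 2242, 2432, 2507, 2635, 2753, 2817]
def EBB : List Ed := [⟨0,4,0,0⟩, ⟨1,6,0,0⟩, ⟨2,10,2,0⟩, ⟨3,10,0,2⟩, ⟨3,13,0,0⟩, ⟨4,1,0,0⟩,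
  ⟨5,4,2,0⟩, ⟨5,16,0,0⟩, ⟨5,17,0,2⟩, ⟨5,18,3,0⟩, ⟨6,15,0,0⟩, ⟨7,0,0,0⟩, ⟨8,10,0,3⟩, ⟨9,11,0,0⟩,
  ⟨10,7,0,0⟩, ⟨11,14,0,0⟩, ⟨12,5,0,0⟩, ⟨13,12,0,0⟩, ⟨14,2,0,0⟩, ⟨15,3,0,0⟩, ⟨16,8,0,0⟩,
  ⟨17,9,0,0⟩, ⟨18,19,0,0⟩, ⟨19,10,0,0⟩]
def LBB : List ℕ := [0, 65, 130, 195, 259, 324, 384, 453, 517, 581, 645, 710, 774, 839, 904, 961,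
  1033, 1095, 1162, 1227, 1292, 1356, 1420, 1484, 1549, 1613, 1677, 1738, 1806, 1863, 1927, 1994,
  2058, 2127, 2191, 2256, 2308, 2385, 2450, 2515, 2566, 2630, 2688]
def EABA : List Ed := [⟨0,6,0,0⟩, ⟨1,15,0,0⟩, ⟨2,1,0,3⟩, ⟨3,1,0,2⟩, ⟨3,5,0,0⟩, ⟨4,11,0,2⟩,
  ⟨4,12,0,0⟩, ⟨4,13,3,0⟩, ⟨4,14,2,0⟩, ⟨5,16,0,0⟩, ⟨6,17,0,0⟩, ⟨7,10,0,0⟩, ⟨8,0,0,0⟩, ⟨9,2,0,0⟩,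
  ⟨10,28,0,0⟩, ⟨11,8,0,0⟩, ⟨12,9,0,0⟩, ⟨13,19,0,0⟩, ⟨14,20,0,0⟩, ⟨15,18,0,0⟩, ⟨16,23,0,0⟩,
  ⟨17,24,0,0⟩, ⟨18,25,0,0⟩, ⟨19,26,0,0⟩, ⟨20,27,0,0⟩, ⟨21,14,0,0⟩, ⟨22,1,2,0⟩, ⟨23,29,0,0⟩,
  ⟨24,31,0,0⟩, ⟨25,21,0,0⟩, ⟨26,1,0,0⟩, ⟨27,30,0,0⟩, ⟨28,3,0,0⟩, ⟨29,4,0,0⟩, ⟨30,7,0,0⟩,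
  ⟨31,22,0,0⟩]
def LABA : List ℕ := [64, 193, 642, 899, 1027, 1092, 1156, 1220, 1284, 1409, 1541, 1734, 1991,
  2248, 2313, 2625, 2698, 2763, 2828, 2893, 2958, 3151, 3280, 3665, 3858, 3905, 4179, 4244, 4373,
  4438, 4623, 4750, 5207, 5271, 5394, 5528, 5657, 5722, 5787, 5852, 5916, 6228, 6557, 6621, 6685,
  6814, 6879, 6991]

theorem row_A {u v} (h : RelW XA u v) (hu : Bg0 u) (hv : Bg1 v) :
    Row 2 3 (sh (-1) (D1 u)) (D0 v) :=
  row_odd (Z := EA) h hu hv 2 3 1 LA 10 12 9 (by decide +kernel) (by decide +kernel)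
    (by decide +kernel) (by decide +kernel)

theorem row_ABA {u v} (h : RelW XABA u v) (hu : Bg0 u) (hv : Bg1 v) :
    Row 5 8 (sh (-1) (D1 u)) (D0 v) :=
  row_odd (Z := EABA) h hu hv 5 8 9 LABA 3 28 25 (by decide +kernel) (by decide +kernel)
    (by decide +kernel) (by decide +kernel)

theorem row_BB {u v} (h : RelW XBB u v) (hu : ∀ t, u t < 2) (hv : ∀ t, v t < 2) :
    Row 3 5 (sh 1 (D0 u)) (D1 v) :=
  row_even (Z := EBB) h hu hv 3 5 0 LBB 3 18 15 (by decide +kernel) (by decide +kernel)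
    (by decide +kernel) (by decide +kernel)

theorem bg_BB {u v} (h : RelW XBB u v) (hu : ∀ t, u t < 2) (hv : ∀ t, v t < 2) :
    Bg1 u ∧ Bg0 v := bg_of h hu hv (by decide +kernel)

end JR


namespace JR

/-! ### Paths and closed paths -/

def Path {α : Type} (R : α → Wd → Wd → Prop) : List α → Wd → Wd → Prop
  | [], u, v => u = v
  | x :: l, u, v => ∃ w, R x u w ∧ Path R l w v

def Closed {α : Type} (R : α → Wd → Wd → Prop) (l : List α) : Prop :=
  ∃ w s, Path R l w (sh s w)

def Equi {α : Type} (R : α → Wd → Wd → Prop) : Prop :=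
  ∀ a u v s, R a u v → R a (sh s u) (sh s v)

section path

variable {α : Type} {R : α → Wd → Wd → Prop}

theorem sh_sh (a b : ℤ) (u : Wd) : sh a (sh b u) = sh (a + b) u := by
  funext t; simp only [sh]; congr 1; ring

theorem sh_zero (u : Wd) : sh 0 u = u := by
  funext t; simp [sh]

theorem path_append {l m : List α} : ∀ {u v}, Path R (l ++ m) u v ↔ ∃ w, Path R l u w ∧ Path R m w v := by
  induction l with
  | nil => intro u v; simp [Path]
  | cons x l ih =>
    intro u v
    simp only [List.cons_append, Path, ih]
    constructor
    · rintro ⟨w, h, w', h', h''⟩; exact ⟨w', ⟨w, h, h'⟩, h''⟩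
    · rintro ⟨w', ⟨w, h, h'⟩, h''⟩; exact ⟨w, h, w', h', h''⟩

theorem Path.shift (hR : Equi R) {l : List α} (s : ℤ) : ∀ {u v}, Path R l u v →
    Path R l (sh s u) (sh s v) := by
  induction l with
  | nil => rintro u v rfl; rfl
  | cons x l ih =>
    rintro u v ⟨w, h, h'⟩
    exact ⟨_, hR _ _ _ _ h, ih h'⟩

theorem Closed.rot (hR : Equi R) {l m : List α} (h : Closed R (l ++ m)) : Closed R (m ++ l) := by
  obtain ⟨w, s, h⟩ := h
  obtain ⟨w', h1, h2⟩ := path_append.1 h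
  exact ⟨w', s, path_append.2 ⟨_, h2, h1.shift hR s⟩⟩

theorem Closed.double (hR : Equi R) {l : List α} (h : Closed R l) : Closed R (l ++ l) := by
  obtain ⟨w, s, h⟩ := h
  refine ⟨w, s + s, path_append.2 ⟨_, h, ?_⟩⟩
  have := h.shift hR s
  rwa [sh_sh] at this

end path

/-! ### The hierarchy of rows -/

def Row' (c d : ℕ) (I O : Wd) : Prop := ∃ s, Row c d (sh s I) O

theorem rowR' {lam mu : ℕ} (hl : 0 < lam) (hm : 0 < mu) {e0 e1 e2 e3}
    (h1 : Row' (2 * lam + mu) (3 * lam + 2 * mu) e0 e1) (h2 : Row' (lam + mu) (2 * lam + mu) e1 e2)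
    (h3 : Row' (2 * lam + mu) (3 * lam + 2 * mu) e2 e3) :
    Row' (5 * lam + 3 * mu) (8 * lam + 5 * mu) e0 e3 := by
  obtain ⟨s1, h1⟩ := h1
  obtain ⟨s2, h2⟩ := h2
  obtain ⟨s3, h3⟩ := h3
  refine ⟨s3 + s2 + s1, ?_⟩
  push_cast at *
  refine rowR (lam := lam) (mu := mu) (by omega) (by omega) (e1 := sh (s3 + s2) e1)
    (e2 := sh s3 e2) ?_ ?_ h3
  · have := h1.shift (s3 + s2); rwa [sh_sh] at this
  · have := h2.shift s3; rwa [sh_sh] at this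

theorem rowE' {lam mu : ℕ} (hl : 0 < lam) (hm : 0 < mu) {e0 e1 e2 e3}
    (h1 : Row' (5 * lam + 3 * mu) (8 * lam + 5 * mu) e0 e1) (h2 : Row' (lam + mu) (2 * lam + mu) e1 e2)
    (h3 : Row' (2 * lam + mu) (3 * lam + 2 * mu) e2 e3) : False := by
  obtain ⟨s1, h1⟩ := h1
  obtain ⟨s2, h2⟩ := h2
  obtain ⟨s3, h3⟩ := h3
  push_cast at *
  refine rowE (lam := lam) (mu := mu) (by omega) (by omega) (e0 := sh (s3 + s2 + s1) e0)
    (e1 := sh (s3 + s2) e1)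
    (e2 := sh s3 e2) ?_ ?_ h3
  · have := h1.shift (s3 + s2); rwa [sh_sh] at this
  · have := h2.shift s3; rwa [sh_sh] at this

def PP (n : ℕ) (u : Wd) : Wd := if n % 2 = 0 then D0 u else D1 u
def BG (n : ℕ) (u : Wd) : Prop := if n % 2 = 0 then Bg1 u else Bg0 u

theorem PP_shift (n u s) : PP n (sh s u) = sh s (PP n u) := by
  unfold PP; split <;> simp [D0_shift, D1_shift]

theorem BG.shift {n u} (h : BG n u) (s) : BG n (sh s u) := by
  unfold BG at *; split at h <;> simp_all [Bg0.shift, Bg1.shift]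

theorem PP_congr {n m} (h : n % 2 = m % 2) : PP n = PP m := by
  funext u; simp [PP, h]
theorem BG_congr {n m} (h : n % 2 = m % 2) : BG n = BG m := by
  funext u; simp [BG, h]

def Rel (n : ℕ) (u v : Wd) : Prop :=
  Row' (n + 2).fib (n + 3).fib (PP n u) (PP (n + 1) v) ∧ BG n u ∧ BG (n + 1) v ∧
    (n = 1 → RelW XA u v)

theorem rel_equi : Equi Rel := by
  rintro n u v s ⟨⟨k, h1⟩, h2, h3, h4⟩
  refine ⟨⟨k, ?_⟩, h2.shift s, h3.shift s, fun h => (h4 h).shift s⟩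
  have := h1.shift s
  rw [sh_sh] at this
  rwa [PP_shift, PP_shift, sh_sh, add_comm k s]

theorem rel_R {n} (hn : 1 ≤ n) {u v w x} (h1 : Rel (n + 1) u v) (h2 : Rel n v w)
    (h3 : Rel (n + 1) w x) : Rel (n + 3) u x := by
  have f2 : (n + 2).fib = (n + 1).fib + n.fib := by rw [Nat.fib_add_two, add_comm]
  have f3 : (n + 3).fib = 2 * (n + 1).fib + n.fib := by
    rw [show n + 3 = (n + 1) + 2 by ring, Nat.fib_add_two, show n + 1 + 1 = n + 2 by ring, f2]; ring
  have f4 : (n + 4).fib = 3 * (n + 1).fib + 2 * n.fib := by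
    rw [show n + 4 = (n + 2) + 2 by ring, Nat.fib_add_two, show n + 2 + 1 = n + 3 by ring, f2, f3]
    ring
  have f5 : (n + 5).fib = 5 * (n + 1).fib + 3 * n.fib := by
    rw [show n + 5 = (n + 3) + 2 by ring, Nat.fib_add_two, show n + 3 + 1 = n + 4 by ring, f4, f3]
    ring
  have f6 : (n + 6).fib = 8 * (n + 1).fib + 5 * n.fib := by
    rw [show n + 6 = (n + 4) + 2 by ring, Nat.fib_add_two, show n + 4 + 1 = n + 5 by ring, f4, f5]
    ring
  obtain ⟨a1, b1, c1, -⟩ := h1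
  obtain ⟨a2, b2, c2, -⟩ := h2
  obtain ⟨a3, b3, c3, -⟩ := h3
  rw [show n + 1 + 2 = n + 3 by ring, show n + 1 + 3 = n + 4 by ring, f3, f4] at a1 a3
  rw [f2, f3] at a2
  rw [show n + 1 + 1 = n + 2 by ring] at a1 a3
  refine ⟨?_, ?_, ?_, by omega⟩
  · rw [show n + 3 + 2 = n + 5 by ring, show n + 3 + 3 = n + 6 by ring, f5, f6,
      PP_congr (show (n + 3) % 2 = (n + 1) % 2 by omega),
      PP_congr (show (n + 3 + 1) % 2 = (n + 2) % 2 by omega)]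
    rw [PP_congr (show (n + 2) % 2 = n % 2 by omega)] at a1
    exact rowR' (Nat.fib_pos.2 (by omega)) (Nat.fib_pos.2 (by omega)) a1 a2 a3
  · rw [BG_congr (show (n + 3) % 2 = (n + 1) % 2 by omega)]; exact b1
  · rw [BG_congr (show (n + 3 + 1) % 2 = (n + 1 + 1) % 2 by omega)]; exact c3

theorem rel_E {n} (hn : 1 ≤ n) {u v w x} (h1 : Rel (n + 3) u v) (h2 : Rel n v w)
    (h3 : Rel (n + 1) w x) : False := by
  have f2 : (n + 2).fib = (n + 1).fib + n.fib := by rw [Nat.fib_add_two, add_comm]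
  have f3 : (n + 3).fib = 2 * (n + 1).fib + n.fib := by
    rw [show n + 3 = (n + 1) + 2 by ring, Nat.fib_add_two, show n + 1 + 1 = n + 2 by ring, f2]; ring
  have f4 : (n + 4).fib = 3 * (n + 1).fib + 2 * n.fib := by
    rw [show n + 4 = (n + 2) + 2 by ring, Nat.fib_add_two, show n + 2 + 1 = n + 3 by ring, f2, f3]
    ring
  have f5 : (n + 5).fib = 5 * (n + 1).fib + 3 * n.fib := by
    rw [show n + 5 = (n + 3) + 2 by ring, Nat.fib_add_two, show n + 3 + 1 = n + 4 by ring, f4, f3]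
    ring
  have f6 : (n + 6).fib = 8 * (n + 1).fib + 5 * n.fib := by
    rw [show n + 6 = (n + 4) + 2 by ring, Nat.fib_add_two, show n + 4 + 1 = n + 5 by ring, f4, f5]
    ring
  obtain ⟨a1, -⟩ := h1
  obtain ⟨a2, -⟩ := h2
  obtain ⟨a3, -⟩ := h3
  rw [show n + 1 + 2 = n + 3 by ring, show n + 1 + 3 = n + 4 by ring, f3, f4] at a3
  rw [f2, f3] at a2
  rw [show n + 3 + 2 = n + 5 by ring, show n + 3 + 3 = n + 6 by ring, f5, f6,
      PP_congr (show (n + 3 + 1) % 2 = n % 2 by omega)] at a1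
  exact rowE' (Nat.fib_pos.2 (by omega)) (Nat.fib_pos.2 (by omega)) a1 a2 a3

/-! Silent windows -/

set_option synthInstance.maxSize 2000 in
set_option synthInstance.maxHeartbeats 400000 in
theorem silent_aux : ∀ a b c d e f g h i : Fin 2,
    bg0 a b c d = true → bg0 b c d e = true → bg0 c d e f = true → bg0 d e f g = true →
    bg0 e f g h = true → bg0 f g h i = true →
    bg1 a b c d = true → bg1 b c d e = true → bg1 c d e f = true → bg1 d e f g = true →
    bg1 e f g h = true → bg1 f g h i = true →
    (dec1 a b c d = 0 → dec1 b c d e = 0 → dec1 c d e f = 0 → dec1 d e f g = 0 →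
      dec1 e f g h = 0 → dec1 f g h i = 0 → False) ∧
    (dec0 a b c d = 0 → dec0 b c d e = 0 → dec0 c d e f = 0 → dec0 d e f g = 0 →
      dec0 e f g h = 0 → dec0 f g h i = 0 → False) := by
  decide +kernel

theorem silent {w : Wd} (h0 : Bg0 w) (h1 : Bg1 w) (n : ℕ) (t : ℤ)
    (h : ∀ s, t ≤ s → s < t + 6 → PP n w s = 0) : False := by
  have key := silent_aux ⟨w (t - 1), h0.lt _⟩ ⟨w t, h0.lt _⟩ ⟨w (t + 1), h0.lt _⟩
    ⟨w (t + 2), h0.lt _⟩ ⟨w (t + 3), h0.lt _⟩ ⟨w (t + 4), h0.lt _⟩ ⟨w (t + 5), h0.lt _⟩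
    ⟨w (t + 6), h0.lt _⟩ ⟨w (t + 7), h0.lt _⟩
  have g : ∀ (F : ℕ → ℕ → ℕ → ℕ → Bool) (hF : ∀ s, F (w s) (w (s + 1)) (w (s + 2)) (w (s + 3)) = true),
      F (w (t - 1)) (w t) (w (t + 1)) (w (t + 2)) = true ∧
      F (w t) (w (t + 1)) (w (t + 2)) (w (t + 3)) = true ∧
      F (w (t + 1)) (w (t + 2)) (w (t + 3)) (w (t + 4)) = true ∧
      F (w (t + 2)) (w (t + 3)) (w (t + 4)) (w (t + 5)) = true ∧
      F (w (t + 3)) (w (t + 4)) (w (t + 5)) (w (t + 6)) = true ∧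
      F (w (t + 4)) (w (t + 5)) (w (t + 6)) (w (t + 7)) = true := by
    intro F hF
    refine ⟨?_, ?_, ?_, ?_, ?_, ?_⟩
    · have := hF (t - 1); ring_nf at this ⊢; exact this
    · have := hF t; ring_nf at this ⊢; exact this
    · have := hF (t + 1); ring_nf at this ⊢; exact this
    · have := hF (t + 2); ring_nf at this ⊢; exact this
    · have := hF (t + 3); ring_nf at this ⊢; exact this
    · have := hF (t + 4); ring_nf at this ⊢; exact this
  obtain ⟨a1, a2, a3, a4, a5, a6⟩ := g bg0 h0
  obtain ⟨b1, b2, b3, b4, b5, b6⟩ := g bg1 h1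
  have key := key a1 a2 a3 a4 a5 a6 b1 b2 b3 b4 b5 b6
  have g' : ∀ (F : ℕ → ℕ → ℕ → ℕ → ℕ)
      (hF : ∀ s, t ≤ s → s < t + 6 → F (w (s - 1)) (w s) (w (s + 1)) (w (s + 2)) = 0),
      F (w (t - 1)) (w t) (w (t + 1)) (w (t + 2)) = 0 ∧
      F (w t) (w (t + 1)) (w (t + 2)) (w (t + 3)) = 0 ∧
      F (w (t + 1)) (w (t + 2)) (w (t + 3)) (w (t + 4)) = 0 ∧
      F (w (t + 2)) (w (t + 3)) (w (t + 4)) (w (t + 5)) = 0 ∧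
      F (w (t + 3)) (w (t + 4)) (w (t + 5)) (w (t + 6)) = 0 ∧
      F (w (t + 4)) (w (t + 5)) (w (t + 6)) (w (t + 7)) = 0 := by
    intro F hF
    refine ⟨?_, ?_, ?_, ?_, ?_, ?_⟩
    · have := hF t (by omega) (by omega); ring_nf at this ⊢; exact this
    · have := hF (t + 1) (by omega) (by omega); ring_nf at this ⊢; exact this
    · have := hF (t + 2) (by omega) (by omega); ring_nf at this ⊢; exact this
    · have := hF (t + 3) (by omega) (by omega); ring_nf at this ⊢; exact this
    · have := hF (t + 4) (by omega) (by omega); ring_nf at this ⊢; exact this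
    · have := hF (t + 5) (by omega) (by omega); ring_nf at this ⊢; exact this
  unfold PP at h
  split at h
  · obtain ⟨a1, a2, a3, a4, a5, a6⟩ := g' dec0 (by simpa [D0] using h)
    exact key.2 a1 a2 a3 a4 a5 a6
  · obtain ⟨a1, a2, a3, a4, a5, a6⟩ := g' dec1 (by simpa [D1] using h)
    exact key.1 a1 a2 a3 a4 a5 a6

theorem Ex.zero {f lo hi E} (h : Ex f lo hi E) {t : ℤ} (h1 : lo ≤ t) (h2 : t < hi)
    (h3 : ∀ q ∈ E, q.1 ≠ t) : f t = 0 := by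
  by_contra hc
  exact h3 _ (h.2 t h1 h2 hc) rfl

theorem row_out_silent {c d : ℤ} (hc : 3 ≤ c) (hd : 5 ≤ d) {I O} (h : Row c d I O) :
    ∃ t, ∀ s, t ≤ s → s < t + 6 → O s = 0 := by
  obtain ⟨S, h1, h2⟩ := h
  obtain ⟨x, hx, -⟩ := h1 0
  obtain ⟨k, hk, -, ho, -⟩ := h2 x hx
  simp only [loops, List.mem_cons, List.not_mem_nil, or_false] at hk
  rcases hk with rfl | rfl | rfl | rfl | rfl <;> simp only [] at ho
  · exact ⟨x, fun s a b => ho.zero a (by omega) (by simp [off])⟩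
  · exact ⟨x + 1, fun s a b => ho.zero (by omega) (by omega) (by simp [off]; omega)⟩
  · exact ⟨x, fun s a b => ho.zero a (by omega) (by simp [off])⟩
  · exact ⟨x + d + 1, fun s a b => ho.zero (by omega) (by omega) (by simp [off]; omega)⟩
  · exact ⟨x + c + 1, fun s a b => ho.zero (by omega) (by omega) (by simp [off]; omega)⟩

theorem row_in_silent {c d : ℤ} (hc : 3 ≤ c) (hd : 5 ≤ d) {I O} (h : Row c d I O) :
    ∃ t, ∀ s, t ≤ s → s < t + 6 → I s = 0 := by
  obtain ⟨S, h1, h2⟩ := h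
  obtain ⟨x, hx, -⟩ := h1 0
  obtain ⟨k, hk, hi, -, hn⟩ := h2 x hx
  obtain ⟨k', hk', hi', -⟩ := h2 _ hn
  refine ⟨x + k.len - 4, fun s a b => ?_⟩
  by_cases hs : s < x + k.len
  · simp only [loops, List.mem_cons, List.not_mem_nil, or_false] at hk
    rcases hk with rfl | rfl | rfl | rfl | rfl <;> simp only [] at * <;>
      exact hi.zero (by omega) (by omega) (by simp [off] <;> omega)
  · generalize x + k.len = y at *
    simp only [loops, List.mem_cons, List.not_mem_nil, or_false] at hk'
    rcases hk' with rfl | rfl | rfl | rfl | rfl <;> simp only [] at * <;>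
      exact hi'.zero (by omega) (by omega) (by simp [off] <;> omega)

theorem fib_ge {n} (hn : 2 ≤ n) : (3 : ℤ) ≤ (n + 2).fib ∧ (5 : ℤ) ≤ (n + 3).fib := by
  constructor
  · have : Nat.fib 4 ≤ (n + 2).fib := Nat.fib_mono (by omega)
    rw [show Nat.fib 4 = 3 by decide] at this; exact_mod_cast this
  · have : Nat.fib 5 ≤ (n + 3).fib := Nat.fib_mono (by omega)
    rw [show Nat.fib 5 = 5 by decide] at this; exact_mod_cast this

theorem rel_parity {n m : ℕ} (hn : 1 ≤ n) (hm : 1 ≤ m) (hp : n % 2 = m % 2) {u v w}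
    (h : Rel n u v) (h' : Rel m v w) : False := by
  have hb : Bg0 v ∧ Bg1 v := by
    have h1 := h.2.2.1
    have h2 := h'.2.1
    unfold BG at h1 h2
    rcases Nat.mod_two_eq_zero_or_one m with hm | hm
    · rw [if_neg (by omega)] at h1
      rw [if_pos (by omega)] at h2
      exact ⟨h1, h2⟩
    · rw [if_pos (by omega)] at h1
      rw [if_neg (by omega)] at h2
      exact ⟨h2, h1⟩
  by_cases h2 : 2 ≤ n
  · obtain ⟨⟨s, hr⟩, -⟩ := h
    obtain ⟨t, ht⟩ := row_out_silent (fib_ge h2).1 (fib_ge h2).2 hr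
    exact silent hb.1 hb.2 _ t ht
  · by_cases h3 : 2 ≤ m
    · obtain ⟨⟨s, hr⟩, -⟩ := h'
      obtain ⟨t, ht⟩ := row_in_silent (fib_ge h3).1 (fib_ge h3).2 hr
      refine silent hb.1 hb.2 m (t + s) fun r h4 h5 => ?_
      have := ht (r - s) (by omega) (by omega)
      simpa [sh] using this
    · exact (cXAA (h.2.2.2 (by omega)) (h'.2.2.2 (by omega))).nil

/-! ### Descent -/

def Over (n : ℕ) (l : List ℕ) : Prop := ∀ x ∈ l, x = n ∨ x = n + 1 ∨ x = n + 2

theorem descD {n} (hn : 1 ≤ n) : ∀ N, ∀ l : List ℕ, l.length ≤ N → Over n l → l.head? ≠ some n →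
    ∀ {u v v1 v2 v3}, Path Rel l u v → Rel (n + 1) v v1 → Rel n v1 v2 → Rel (n + 1) v2 v3 →
    ∃ l', Over (n + 1) l' ∧ Path Rel l' u v ∧ l'.length ≤ l.length ∧
      (n ∈ l → l'.length < l.length) ∧ (l ≠ [] → l' ≠ []) := by
  intro N
  induction N with
  | zero =>
    intro l hl _ _ u v v1 v2 v3 hp _ _ _
    obtain rfl : l = [] := List.length_eq_zero_iff.1 (by omega)
    exact ⟨[], by simp [Over], hp, by simp, by simp, by simp⟩
  | succ N ih =>
    intro l hl ho hh u v v1 v2 v3 hp k1 k2 k3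
    match l, hl, ho, hh, hp with
    | [], _, _, _, hp => exact ⟨[], by simp [Over], hp, by simp, by simp, by simp⟩
    | x :: r, hl, ho, hh, ⟨w, hx, hr⟩ =>
      have hxn : x ≠ n := by simpa using hh
      have ho' : Over n r := fun y hy => ho y (List.mem_cons_of_mem _ hy)
      have hxo := ho x (by simp)
      simp only [List.length_cons] at hl
      by_cases hrn : r.head? = some n
      · match r, hrn, hr with
        | y :: r2, hrn, ⟨w2, hy, hr2⟩ =>
          obtain rfl : y = n := by simpa using hrn
          obtain rfl : x = y + 1 := by
            rcases hxo with h | h | h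
            · exact absurd h hxn
            · exact h
            · exact (rel_parity (by omega) (by omega) (by omega) hx hy).elim
          match r2, hr2 with
          | [], hr2 => rw [Path] at hr2; subst hr2; exact (rel_E hn (rel_R hn hx hy k1) k2 k3).elim
          | z :: r3, ⟨w3, hz, hr3⟩ =>
            obtain rfl : z = y + 1 := by
              rcases ho' z (by simp) with h | h | h
              · exact (rel_parity (by omega) (by omega) (by omega) hy hz).elim
              · exact h
              · exact (rel_parity (by omega) (by omega) (by omega) hy hz).elim
            have hR := rel_R hn hx hy hz
            by_cases h3n : r3.head? = some y
            · match r3, h3n, hr3 with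
              | a :: r4, h3n, ⟨w4, ha, hr4⟩ =>
                obtain rfl : a = y := by simpa using h3n
                match r4, hr4 with
                | [], hr4 => rw [Path] at hr4; subst hr4; exact (rel_E hn hR ha k1).elim
                | b :: r5, ⟨w5, hb, hr5⟩ =>
                  rcases ho' b (by simp) with h | h | h
                  · exact (rel_parity (by omega) (by omega) (by omega) ha hb).elim
                  · exact (rel_E hn hR ha (h ▸ hb)).elim
                  · exact (rel_parity (by omega) (by omega) (by omega) ha hb).elim
            · simp only [List.length_cons] at hl
              obtain ⟨l', q1, q2, q3, q4, q5⟩ := ih r3 (by omega)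
                (fun c hc => ho' c (by simp [hc])) h3n hr3 k1 k2 k3
              refine ⟨(y + 3) :: l', ?_, ⟨_, hR, q2⟩, ?_, ?_, by simp⟩
              · intro c hc
                rcases List.mem_cons.1 hc with rfl | hc
                · omega
                · exact q1 c hc
              · simp only [List.length_cons]; omega
              · simp only [List.length_cons]; omega
      · obtain ⟨l', q1, q2, q3, q4, q5⟩ := ih r (by omega) ho' hrn hr k1 k2 k3
        refine ⟨x :: l', ?_, ⟨_, hx, q2⟩, ?_, ?_, by simp⟩
        · intro c hc
          rcases List.mem_cons.1 hc with rfl | hc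
          · omega
          · exact q1 c hc
        · simp only [List.length_cons]; omega
        · intro hm
          rcases List.mem_cons.1 hm with h | h
          · exact absurd h.symm hxn
          · have := q4 h
            simp only [List.length_cons]; omega

theorem Over.perm {n l m} (h : Over n l) (hp : l.Perm m) : Over n m :=
  fun x hx => h x (hp.mem_iff.2 hx)

theorem descA {n} (hn : 1 ≤ n) {l : List ℕ} (ho : Over n l) (hc : Closed Rel l) (hm : n ∈ l) :
    ∃ l', l' ≠ [] ∧ Over (n + 1) l' ∧ Closed Rel l' ∧ l'.length < l.length := by
  obtain ⟨a, b, rfl⟩ := List.append_of_mem hm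
  have hc1 := hc.rot rel_equi
  obtain ⟨r, hr⟩ : ∃ r, r = b ++ a := ⟨_, rfl⟩
  rw [List.cons_append, ← hr] at hc1
  have ho1 : Over n (n :: r) := ho.perm (by
    rw [hr]; exact (List.perm_append_comm (l₁ := a) (l₂ := n :: b)))
  have hlen : (a ++ n :: b).length = (n :: r).length := by rw [hr]; simp; omega
  rw [hlen]
  clear hlen ho hc hm hr a b
  rcases List.eq_nil_or_concat r with rfl | ⟨r', x, rfl⟩
  · obtain ⟨w, s, w', h, rfl⟩ := hc1
    exact (rel_parity hn hn rfl h (rel_equi _ _ _ s h)).elim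
  · simp only [List.concat_eq_append] at *
    have hc2 : Closed Rel (x :: n :: r') := Closed.rot rel_equi (l := n :: r') (m := [x]) hc1
    have ho2 : Over n (x :: n :: r') := ho1.perm (by
      exact (List.perm_append_comm (l₁ := n :: r') (l₂ := [x])))
    obtain ⟨w, s, hp⟩ := hc2
    have hp' := hp
    obtain ⟨w1, h1, w2, h2, h3⟩ := hp'
    obtain rfl : x = n + 1 := by
      rcases ho2 x (by simp) with h | h | h
      · exact (rel_parity (by omega) (by omega) (by omega) h1 h2).elim
      · exact h
      · exact (rel_parity (by omega) (by omega) (by omega) h1 h2).elim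
    have hk : ∃ w3, Rel (n + 1) w2 w3 := by
      match r', h3 with
      | [], h3 => rw [Path] at h3; subst h3; exact ⟨_, rel_equi _ _ _ s h1⟩
      | y :: r'', ⟨w3, hy, _⟩ =>
        rcases ho2 y (by simp) with h | h | h
        · exact (rel_parity (by omega) (by omega) (by omega) h2 hy).elim
        · exact ⟨w3, h ▸ hy⟩
        · exact (rel_parity (by omega) (by omega) (by omega) h2 hy).elim
    obtain ⟨w3, h4⟩ := hk
    obtain ⟨l', q1, q2, q3, q4, q5⟩ := descD hn _ _ le_rfl ho2 (by simp) hp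
      (rel_equi _ _ _ s h1) (rel_equi _ _ _ s h2) (rel_equi _ _ _ s h4)
    refine ⟨l', q5 (by simp), q1, ⟨w, s, q2⟩, ?_⟩
    have := q4 (by simp)
    simpa using this

theorem no_closed_rel : ∀ N n, 1 ≤ n → ∀ l : List ℕ, l.length ≤ N → l ≠ [] → Over n l →
    Closed Rel l → False := by
  intro N
  induction N with
  | zero =>
    intro n _ l hl hne
    exact (hne (List.length_eq_zero_iff.1 (by omega))).elim
  | succ N ih =>
    intro n hn l hl hne ho hc
    by_cases h1 : n ∈ l
    · obtain ⟨l', a, b, c, d⟩ := descA hn ho hc h1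
      exact ih (n + 1) (by omega) l' (by omega) a b c
    · have ho' : Over (n + 1) l := fun x hx => by
        rcases ho x hx with h | h | h
        · exact (h1 (h ▸ hx)).elim
        · omega
        · omega
      by_cases h2 : n + 1 ∈ l
      · obtain ⟨l', a, b, c, d⟩ := descA (by omega) ho' hc h2
        exact ih (n + 1 + 1) (by omega) l' (by omega) a b c
      · have h3 : ∀ x ∈ l, x = n + 2 := fun x hx => by
          rcases ho x hx with h | h | h
          · exact (h1 (h ▸ hx)).elim
          · exact (h2 (h ▸ hx)).elim
          · exact h
        match l, hne, hc.double rel_equi, h3 with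
        | [x], _, ⟨w, s, w', h, w'', h', _⟩, h3 =>
          have := h3 x (by simp)
          exact rel_parity (by omega) (by omega) rfl h h'
        | x :: y :: r, _, ⟨w, s, w', h, w'', h', _⟩, h3 =>
          have := h3 x (by simp)
          have := h3 y (by simp)
          exact rel_parity (by omega) (by omega) (by omega) h h'

end JR


namespace JR

/-! ### Parsing a closed sequence of tile rows -/

def RT : Bool → Wd → Wd → Prop
  | true => RelW X1
  | false => RelW X0

def RAB : Bool → Wd → Wd → Prop
  | true => RelW XA
  | false => RelW XB

theorem RT_equi : Equi RT := by
  rintro (_ | _) u v s h <;> exact RelW.shift h s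

theorem RAB_equi : Equi RAB := by
  rintro (_ | _) u v s h <;> exact RelW.shift h s

theorem X1_lt {u v} (h : RelW X1 u v) (t) : u t < 2 := h.in_lt 2 (by decide) t
theorem XA_lt {u v} (h : RelW XA u v) (t) : u t < 2 := h.in_lt 2 (by decide) t
theorem XB_lt {u v} (h : RelW XB u v) (t) : u t < 2 := h.in_lt 2 (by decide) t

theorem next1 {r u v v'} (h : Path RT r u v) (h' : RelW X1 v v') :
    ((∃ u', RelW X1 u u') ∧ r.head? ≠ some false) ∨
      ∃ r' w, r = false :: r' ∧ RelW X0 u w ∧ Path RT r' w v := by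
  match r, h with
  | [], h => rw [Path] at h; subst h; exact Or.inl ⟨⟨_, h'⟩, by simp⟩
  | true :: r, ⟨w, h, _⟩ => exact Or.inl ⟨⟨w, h⟩, by simp⟩
  | false :: r, ⟨w, h, h2⟩ => exact Or.inr ⟨r, w, rfl, h, h2⟩

theorem parse1 : ∀ N, ∀ l : List Bool, l.length ≤ N → l.head? ≠ some false →
    ∀ {u v v'}, Path RT l u v → RelW X1 v v' →
    ∃ l', Path RAB l' u v ∧ (l ≠ [] → l' ≠ []) := by
  intro N
  induction N with
  | zero =>
    intro l hl _ u v v' hp _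
    obtain rfl : l = [] := List.length_eq_zero_iff.1 (by omega)
    exact ⟨[], hp, by simp⟩
  | succ N ih =>
    intro l hl hh u v v' hp hv
    match l, hl, hh, hp with
    | [], _, _, hp => exact ⟨[], hp, by simp⟩
    | false :: r, _, hh, _ => simp at hh
    | true :: r, hl, hh, ⟨w, h1, hr⟩ =>
      have h1 : RelW X1 u w := h1
      rcases next1 hr hv with ⟨⟨_, h2⟩, -⟩ | ⟨r1, w1, rfl, h2, hr1⟩
      · exact (cX11 h1 h2).nil.elim
      have h12 := cX10 h1 h2
      rcases next1 hr1 hv with ⟨⟨_, h3⟩, -⟩ | ⟨r2, w2, rfl, h3, hr2⟩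
      · exact (cX101 h12 h3).nil.elim
      have h13 := cX100 h12 h3
      rcases next1 hr2 hv with ⟨⟨_, h4⟩, -⟩ | ⟨r3, w3, rfl, h4, hr3⟩
      · exact (cX1001 h13 h4).nil.elim
      simp only [List.length_cons] at hl
      rcases next1 hr3 hv with ⟨⟨_, h5⟩, hh3⟩ | ⟨r4, w4, rfl, h5, hr4⟩
      · obtain ⟨l', q1, q2⟩ := ih r3 (by omega) hh3 hr3 hv
        exact ⟨true :: l', ⟨_, cXA h13 h4 (X1_lt h5), q1⟩, by simp⟩
      simp only [List.length_cons] at hl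
      have h14 := cX1000 h13 h4
      rcases next1 hr4 hv with ⟨⟨_, h6⟩, hh4⟩ | ⟨r5, w5, rfl, h6, hr5⟩
      · obtain ⟨l', q1, q2⟩ := ih r4 (by omega) hh4 hr4 hv
        exact ⟨false :: l', ⟨_, cXB h14 h5 (X1_lt h6), q1⟩, by simp⟩
      · exact (cX00000 (cX000 (cX00 h2 h3) h4) (cX00 h5 h6)).nil.elim

theorem XB_out {u v} (h : RelW XB u v) (t) : v t < 2 := by
  obtain ⟨r, hr, hu, hv⟩ := h
  rw [hv]
  exact (show ∀ a ∈ XB, a.n < 2 by decide) _ (hr t).1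

theorem bgBB {u v w} (h1 : RelW XB u v) (h2 : RelW XB v w) : Bg1 u ∧ Bg0 w :=
  bg_BB (cXBB h1 h2) (XB_lt h1) (XB_out h2)

theorem rel2 {u v w} (h1 : RelW XB u v) (h2 : RelW XB v w) : Rel 2 u w :=
  ⟨⟨1, row_BB (cXBB h1 h2) (XB_lt h1) (XB_out h2)⟩, (bgBB h1 h2).1, (bgBB h1 h2).2, by omega⟩

theorem rel1 {u v} (h : RelW XA u v) (hu : Bg0 u) (hv : Bg1 v) : Rel 1 u v :=
  ⟨⟨-1, row_A h hu hv⟩, hu, hv, fun _ => h⟩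

theorem rel3 {u v w x} (h1 : RelW XA u v) (h2 : RelW XB v w) (h3 : RelW XA w x)
    (hu : Bg0 u) (hv : Bg1 x) : Rel 3 u x :=
  ⟨⟨-1, row_ABA (cXABA (cXAB h1 h2) h3) hu hv⟩, hu, hv, by omega⟩

/-- The next two rows are `B`, `B`, or the next one is `A`, or the next ones are `B`, `A`. -/
theorem next2 {r u v v1 v2} (h : Path RAB r u v) (h1 : RelW XB v v1) (h2 : RelW XB v1 v2) :
    ((∃ a b, RelW XB u a ∧ RelW XB a b) ∧ (r = [] ∨ ∃ r', r = false :: false :: r')) ∨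
    (∃ r' w, r = true :: r' ∧ RelW XA u w ∧ Path RAB r' w v) ∨
    ∃ r' w w', r = false :: true :: r' ∧ RelW XB u w ∧ RelW XA w w' ∧ Path RAB r' w' v := by
  match r, h with
  | [], h => rw [Path] at h; subst h; exact Or.inl ⟨⟨_, _, h1, h2⟩, Or.inl rfl⟩
  | true :: r, ⟨w, h, h'⟩ => exact Or.inr (Or.inl ⟨r, w, rfl, h, h'⟩)
  | [false], ⟨w, g, g'⟩ =>
    rw [Path] at g'; subst g'
    exact (cXBBB (cXBB g h1) h2).nil.elim
  | false :: false :: r, ⟨w, h, w', h', _⟩ => exact Or.inl ⟨⟨_, _, h, h'⟩, Or.inr ⟨r, rfl⟩⟩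
  | false :: true :: r, ⟨w, h, w', h', h''⟩ => exact Or.inr (Or.inr ⟨r, w, w', rfl, h, h', h''⟩)

theorem parse2 : ∀ N, ∀ l : List Bool, l.length ≤ N → (l = [] ∨ ∃ r', l = false :: false :: r') →
    ∀ {u v v1 v2}, Path RAB l u v → RelW XB v v1 → RelW XB v1 v2 →
    ∃ l', Path Rel l' u v ∧ Over 1 l' ∧ (l ≠ [] → l' ≠ []) := by
  intro N
  induction N with
  | zero =>
    intro l hl _ u v v1 v2 hp _ _
    obtain rfl : l = [] := List.length_eq_zero_iff.1 (by omega)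
    exact ⟨[], hp, by simp [Over], by simp⟩
  | succ N ih =>
    intro l hl hh u v v1 v2 hp k1 k2
    rcases hh with rfl | ⟨r, rfl⟩
    · exact ⟨[], hp, by simp [Over], by simp⟩
    obtain ⟨w, b1, w2, b2, hr⟩ := hp
    have b1 : RelW XB u w := b1
    have b2 : RelW XB w w2 := b2
    have hR2 := rel2 b1 b2
    have hbg := (bgBB b1 b2).2
    rcases next2 hr k1 k2 with ⟨⟨_, _, h, -⟩, -⟩ | ⟨r1, w3, rfl, a1, hr1⟩ | ⟨_, _, _, _, h, -⟩
    · exact (cXBBB (cXBB b1 b2) h).nil.elim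
    · simp only [List.length_cons] at hl
      rcases next2 hr1 k1 k2 with ⟨⟨_, _, h, h'⟩, hh⟩ | ⟨_, _, _, h, -⟩ | ⟨r2, w4, w5, rfl, b3, a2, hr2⟩
      · obtain ⟨l', q1, q2, -⟩ := ih r1 (by omega) hh hr1 k1 k2
        refine ⟨2 :: 1 :: l', ⟨_, hR2, _, rel1 a1 hbg (bgBB h h').1, q1⟩, ?_, by simp⟩
        intro x hx
        simp only [List.mem_cons] at hx
        rcases hx with rfl | rfl | hx
        · omega
        · omega
        · exact q2 x hx
      · exact (cXAA a1 h).nil.elim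
      · simp only [List.length_cons] at hl
        rcases next2 hr2 k1 k2 with ⟨⟨_, _, h, h'⟩, hh⟩ | ⟨_, _, _, h, -⟩ | ⟨_, _, _, _, b4, a3, -⟩
        · obtain ⟨l', q1, q2, -⟩ := ih r2 (by omega) hh hr2 k1 k2
          refine ⟨2 :: 3 :: l', ⟨_, hR2, _, rel3 a1 b3 a2 hbg (bgBB h h').1, q1⟩, ?_, by simp⟩
          intro x hx
          simp only [List.mem_cons] at hx
          rcases hx with rfl | rfl | hx
          · omega
          · omega
          · exact q2 x hx
        · exact (cXAA a2 h).nil.elim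
        · exact (cXABABA (cXABA (cXAB a1 b3) a2) (cXBA b4 a3)).nil.elim
    · exact (cXBBB (cXBB b1 b2) h).nil.elim

theorem no_closed_BB {r} (h : Closed RAB (false :: false :: r)) : False := by
  obtain ⟨w, s, hp⟩ := h
  have hp' := hp
  obtain ⟨w1, h1, w2, h2, -⟩ := hp'
  obtain ⟨l', q1, q2, q3⟩ := parse2 _ _ le_rfl (Or.inr ⟨r, rfl⟩) hp (RelW.shift h1 s)
    (RelW.shift h2 s)
  exact no_closed_rel _ 1 le_rfl l' le_rfl (q3 (by simp)) q2 ⟨w, s, q1⟩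

theorem double3 {l : List Bool} {R} (hR : Equi R) (hne : l ≠ []) (h : Closed R l) :
    ∃ m : List Bool, (∀ x ∈ m, x ∈ l) ∧ 8 ≤ m.length ∧ Closed R m := by
  refine ⟨_, ?_, ?_, ((h.double hR).double hR).double hR⟩
  · intro x hx; simpa using hx
  · have := List.length_pos_of_ne_nil hne
    simp; omega

theorem no_closed_AB {l} (hne : l ≠ []) (h : Closed RAB l) : False := by
  obtain ⟨m, -, hl, hm⟩ := double3 RAB_equi hne h
  clear h hne l
  have hBB : ∀ a b, m ≠ a ++ false :: false :: b := by
    rintro a b rfl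
    have := hm.rot RAB_equi
    exact no_closed_BB this
  match m, hl, hm with
  | x1 :: x2 :: x3 :: x4 :: x5 :: x6 :: r, _, ⟨w, s, w1, h1, w2, h2, w3, h3, w4, h4, w5, h5, w6, h6, _⟩ =>
    have alt : ∀ a x y b, x1 :: x2 :: x3 :: x4 :: x5 :: x6 :: r = a ++ x :: y :: b →
        (∃ p q t, RAB x p q ∧ RAB y q t) → x = !y := by
      rintro a x y b e ⟨p, q, t, hx, hy⟩
      match x, y with
      | true, true => exact (cXAA hx hy).nil.elim
      | true, false => rfl
      | false, true => rfl
      | false, false => exact (hBB a b e).elim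
    have e1 := alt [] x1 x2 _ rfl ⟨_, _, _, h1, h2⟩
    have e2 := alt [x1] x2 x3 _ rfl ⟨_, _, _, h2, h3⟩
    have e3 := alt [x1, x2] x3 x4 _ rfl ⟨_, _, _, h3, h4⟩
    have e4 := alt [x1, x2, x3] x4 x5 _ rfl ⟨_, _, _, h4, h5⟩
    have e5 := alt [x1, x2, x3, x4] x5 x6 _ rfl ⟨_, _, _, h5, h6⟩
    clear alt hBB
    subst e1 e2 e3 e4 e5
    cases x6
    · exact (cXABABA (cXABA (cXAB h1 h2) h3) (cXBA h4 h5)).nil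
    · exact (cXABABA (cXABA (cXAB h2 h3) h4) (cXBA h5 h6)).nil

theorem no_closed_T {l} (hne : l ≠ []) (h : Closed RT l) : False := by
  by_cases ht : true ∈ l
  · obtain ⟨a, b, rfl⟩ := List.append_of_mem ht
    have hc : Closed RT (true :: (b ++ a)) := h.rot RT_equi
    obtain ⟨w, s, hp⟩ := hc
    have hp' := hp
    obtain ⟨w1, h1, -⟩ := hp'
    obtain ⟨l', q1, q2⟩ := parse1 _ _ le_rfl (by simp) hp (RelW.shift h1 s)
    exact no_closed_AB (q2 (by simp)) ⟨w, s, q1⟩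
  · obtain ⟨m, hm, hl, hc⟩ := double3 RT_equi hne h
    match m, hm, hl, hc with
    | x1 :: x2 :: x3 :: x4 :: x5 :: r, hm, _, ⟨w, s, w1, h1, w2, h2, w3, h3, w4, h4, w5, h5, _⟩ =>
      have : ∀ x ∈ x1 :: x2 :: x3 :: x4 :: x5 :: r, x = false := by
        intro x hx
        have := hm x hx
        cases x
        · rfl
        · exact (ht this).elim
      obtain rfl := this x1 (by simp)
      obtain rfl := this x2 (by simp)
      obtain rfl := this x3 (by simp)
      obtain rfl := this x4 (by simp)
      obtain rfl := this x5 (by simp)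
      exact (cX00000 (cX000 (cX00 h1 h2) h3) (cX00 h4 h5)).nil

end JR


namespace JR

/-! ### No periodic tiling -/

abbrev WT := WangTile (Fin 4) (Fin 5)

def edOf (t : WT) : Ed := ⟨t.west, t.east, t.south, t.north⟩

theorem T11_cases {t : WT} (h : t ∈ T11) :
    (edOf t ∈ X0 ∧ t.west ≠ 2 ∧ t.east ≠ 2) ∨ (edOf t ∈ X1 ∧ t.west = 2 ∧ t.east = 2) := by
  simp only [T11, T₀, T₁, Set.mem_union, Set.mem_insert_iff, Set.mem_singleton_iff] at h
  rcases h with (h | h | h | h | h | h | h | h | h) | (h | h) <;> subst h <;> decide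

def Sw (f : ℤ × ℤ → WT) (y : ℤ) : Wd := fun x => (f (x, y)).south

theorem row_RT {f} (hf : Tiling T11 f) (y : ℤ) : ∃ b, RT b (Sw f y) (Sw f (y + 1)) := by
  obtain ⟨h1, h2, h3⟩ := hf
  have h1 := fun p => h1 p trivial
  have h2 := fun x y => h2 x y trivial trivial
  have h3 := fun x y => h3 x y trivial trivial
  have hconst : ∀ x, (f (x, y)).west = 2 ↔ (f (x + 1, y)).west = 2 := by
    intro x
    rw [← h2]
    rcases T11_cases (h1 (x, y)) with ⟨_, a, b⟩ | ⟨_, a, b⟩ <;> simp [a, b]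
  have hc : ∀ x, (f (x, y)).west = 2 ↔ (f (0, y)).west = 2 := by
    intro x
    induction x using Int.induction_on with
    | zero => rfl
    | succ i ih => rw [← hconst, ih]
    | pred i ih => rw [hconst, sub_add_cancel, ih]
  have key : ∀ X, (∀ x, edOf (f (x, y)) ∈ X) → RelW X (Sw f y) (Sw f (y + 1)) := by
    intro X hX
    refine ⟨fun x => edOf (f (x, y)), fun x => ⟨hX x, ?_⟩, fun x => rfl, fun x => ?_⟩
    · simp only [edOf]; rw [h2]
    · simp only [Sw, edOf]; rw [h3]
  by_cases h0 : (f (0, y)).west = 2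
  · refine ⟨true, key X1 fun x => ?_⟩
    rcases T11_cases (h1 (x, y)) with ⟨_, a, b⟩ | ⟨h, a, b⟩
    · exact (a ((hc x).2 h0)).elim
    · exact h
  · refine ⟨false, key X0 fun x => ?_⟩
    rcases T11_cases (h1 (x, y)) with ⟨h, a, b⟩ | ⟨_, a, b⟩
    · exact h
    · exact (h0 ((hc x).1 a)).elim

theorem path_RT {f} (hf : Tiling T11 f) (k : ℕ) : ∀ y : ℤ, ∃ l : List Bool, l.length = k ∧
    Path RT l (Sw f y) (Sw f (y + k)) := by
  induction k with
  | zero => intro y; exact ⟨[], rfl, by simp [Path]⟩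
  | succ k ih =>
    intro y
    obtain ⟨b, hb⟩ := row_RT hf y
    obtain ⟨l, hl, hp⟩ := ih (y + 1)
    refine ⟨b :: l, by simp [hl], _, hb, ?_⟩
    convert hp using 2
    push_cast; ring

theorem no_word_rep {f} (hf : Tiling T11 f) (y : ℤ) (k : ℕ) (hk : 0 < k) (s : ℤ)
    (h : Sw f (y + k) = sh s (Sw f y)) : False := by
  obtain ⟨l, hl, hp⟩ := path_RT hf k y
  refine no_closed_T (l := l) (by rintro rfl; simp at hl; omega) ⟨_, s, h ▸ hp⟩

theorem no_periodic {f} (hf : Tiling T11 f) : ¬ PeriodicTiling f := by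
  rintro ⟨u, v, huv, hper⟩
  have pos : ∀ (u : ℤ) (v : ℕ), 0 < v → (∀ x y : ℤ, f (x + u, y + v) = f (x, y)) → False := by
    intro u v hv hp
    refine no_word_rep hf 0 v hv (-u) ?_
    funext x
    have := hp (x + -u) 0
    simp only [Sw, sh]
    rw [← this]
    congr 3; ring_nf
  rcases lt_trichotomy v 0 with hv | hv | hv
  · refine pos (-u) (-v).toNat (by omega) fun x y => ?_
    have := hper (x + -u) (y + -v)
    rw [Int.toNat_of_nonneg (by omega), ← this]
    congr 2 <;> ring_nf
  · subst hv
    have hu : u ≠ 0 := fun h => huv (by simp [h])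
    have hmul : ∀ (k : ℤ) x y, f (x + k * u, y) = f (x, y) := by
      intro k
      induction k using Int.induction_on with
      | zero => intro x y; simp
      | succ i ih =>
        intro x y
        rw [← ih x y, ← hper (x + i * u) y]; congr 2 <;> ring_nf
      | pred i ih =>
        intro x y
        rw [← ih x y, ← hper (x + (-i - 1) * u) y]; congr 2 <;> ring_nf
    have key : ∀ y1 y2 : ℕ, y1 < y2 →
        (∀ i : Fin u.natAbs, (f ((i : ℕ), y1)).south = (f ((i : ℕ), y2)).south) → False := by
      intro y1 y2 hlt h
      refine no_word_rep hf y1 (y2 - y1) (by omega) 0 ?_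
      rw [sh_zero]
      funext x
      have e : ∀ y, f (x, y) = f (x % u, y) := by
        intro y
        rw [← hmul (-(x / u)) x y]
        congr 2
        have := Int.emod_add_mul_ediv x u
        linarith [mul_comm u (x / u)]
      simp only [Sw]
      rw [e, e]
      have h0 := Int.emod_nonneg x hu
      have h1 := Int.emod_lt_abs x hu
      have := h ⟨(x % u).toNat, by
        have : (u.natAbs : ℤ) = |u| := Int.natCast_natAbs u
        omega⟩
      simp only [Int.toNat_of_nonneg h0] at this
      rw [this]
      congr 4; omega
    obtain ⟨y1, y2, hne, heq⟩ := Finite.exists_ne_map_eq_of_infinite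
      (fun y : ℕ => fun i : Fin u.natAbs => (f ((i : ℕ), (y : ℤ))).south)
    have h := fun i => congrFun heq i
    rcases lt_or_gt_of_ne hne with hlt | hlt
    · exact key _ _ hlt h
    · exact key _ _ hlt fun i => (h i).symm
  · refine pos u v.toNat (by omega) fun x y => ?_
    rw [Int.toNat_of_nonneg (by omega)]; exact hper x y

end JR


namespace JR

/-! ### Existence: rows as sequences of states -/

inductive Q where
  | a | b | g | d
deriving DecidableEq

abbrev St := Q × ℕ

def len (c d : ℕ) : Q → ℕ
  | .a => c + d
  | .b => c + d
  | .g => c + d + d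
  | .d => c + d + d

def inE (c : ℕ) : St → ℕ
  | (.a, j) => if j = c then 2 else 0
  | (.g, j) => if j = c then 3 else 0
  | (.b, _) => 0
  | (.d, _) => 0

def outE (d : ℕ) : St → ℕ
  | (.b, j) => if j = 0 then 2 else 0
  | (.d, j) => if j = d then 3 else 0
  | (.a, _) => 0
  | (.g, _) => 0

def Nx (c d : ℕ) (s s' : St) : Prop :=
  (s.2 + 1 < len c d s.1 ∧ s' = (s.1, s.2 + 1)) ∨ (s.2 + 1 = len c d s.1 ∧ s'.2 = 0)

def SRow (c d : ℕ) (st : ℤ → St) : Prop :=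
  ∀ t, (st t).2 < len c d (st t).1 ∧ Nx c d (st t) (st (t + 1))

def Rs (c d : ℕ) (I O : Wd) : Prop :=
  ∃ st, SRow c d st ∧ I = (fun t => inE c (st t)) ∧ O = fun t => outE d (st t)

def walk (c d : ℕ) : List Q → ℕ → St
  | [], _ => (.a, 0)
  | k :: w, p => if p < len c d k then (k, p) else walk c d w (p - len c d k)

def tot (c d : ℕ) (w : List Q) : ℕ := (w.map (len c d)).sum

section walk
variable {c d : ℕ}

theorem len_pos (hc : 0 < c) (k : Q) : 0 < len c d k := by
  cases k <;> simp only [len] <;> omega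

theorem walk_zero (hc : 0 < c) (w : List Q) : (walk c d w 0).2 = 0 := by
  cases w with
  | nil => rfl
  | cons k w => simp [walk, len_pos hc k]

theorem walk_valid : ∀ {w : List Q} {p : ℕ}, p < tot c d w →
    (walk c d w p).2 < len c d (walk c d w p).1
  | [], p, h => by simp [tot] at h
  | k :: w, p, h => by
    simp only [tot, List.map_cons, List.sum_cons] at h
    rw [walk]
    split
    · assumption
    · exact walk_valid (w := w) (by rw [tot]; omega)

theorem walk_step (hc : 0 < c) : ∀ {w : List Q} {p : ℕ}, p + 1 < tot c d w →
    Nx c d (walk c d w p) (walk c d w (p + 1))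
  | [], p, h => by simp [tot] at h
  | k :: w, p, h => by
    simp only [tot, List.map_cons, List.sum_cons] at h
    by_cases h1 : p + 1 < len c d k
    · simp only [walk, if_pos h1, if_pos (show p < len c d k by omega)]
      exact Or.inl ⟨h1, rfl⟩
    · by_cases h2 : p < len c d k
      · simp only [walk, if_neg h1, if_pos h2]
        refine Or.inr ⟨by simp only; omega, ?_⟩
        rw [show p + 1 - len c d k = 0 by omega]
        exact walk_zero hc w
      · simp only [walk, if_neg h1, if_neg h2]
        rw [show p + 1 - len c d k = p - len c d k + 1 by omega]
        exact walk_step hc (by rw [tot]; omega)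

theorem walk_append (w' : List Q) (p : ℕ) : ∀ w : List Q,
    walk c d (w ++ w') (tot c d w + p) = walk c d w' p
  | [] => by simp [tot]
  | k :: w => by
    simp only [tot, List.map_cons, List.sum_cons, List.cons_append, walk]
    rw [if_neg (by omega)]
    rw [← walk_append w' p w]
    congr 1
    simp only [tot]; omega

/-- The map from states of a long row to states of one of the rows it is made of. -/
def phi (c d : ℕ) (pre : Q) (o : ℕ) (V : Q → List Q) (s : St) : St :=
  walk c d (pre :: (V s.1 ++ [pre])) (s.2 + o)

theorem phi_row {c' d' : ℕ} (hc : 0 < c) {pre : Q} {o : ℕ} {V : Q → List Q} (h0 : 0 < o)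
    (ho : o ≤ len c d pre) (hV : ∀ k, tot c d (pre :: V k) = len c' d' k) {st}
    (h : SRow c' d' st) : SRow c d (fun t => phi c d pre o V (st t)) := by
  have hT : ∀ k, tot c d (pre :: (V k ++ [pre])) = len c' d' k + len c d pre := by
    intro k
    rw [← hV]; simp [tot]; omega
  intro t
  obtain ⟨h1, h2⟩ := h t
  refine ⟨walk_valid (by rw [hT]; omega), ?_⟩
  rcases h2 with ⟨h2, h3⟩ | ⟨h2, h3⟩
  · simp only [phi, h3]
    rw [show (st t).2 + 1 + o = (st t).2 + o + 1 by ring]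
    exact walk_step hc (by rw [hT]; omega)
  · simp only [phi, h3]
    have e1 : walk c d (pre :: (V (st t).1 ++ [pre])) ((st t).2 + o) = (pre, o - 1) := by
      rw [← List.cons_append, show (st t).2 + o = tot c d (pre :: V (st t).1) + (o - 1) by
        rw [hV]; omega, walk_append, walk, if_pos (by omega)]
    rw [e1]
    by_cases h4 : o < len c d pre
    · rw [walk, if_pos (by omega)]
      refine Or.inl ⟨by simp only; omega, ?_⟩
      simp only [Prod.mk.injEq, true_and]; omega
    · rw [walk, if_neg (by omega), show 0 + o - len c d pre = 0 by omega]
      exact Or.inr ⟨by simp only; omega, walk_zero hc _⟩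

end walk

def VL : Q → List Q
  | .a => [.a] | .b => [.b] | .g => [.g, .b] | .d => [.d, .b]
def VM : Q → List Q
  | .a => [.b, .d] | .b => [.a, .d] | .g => [.b, .d, .a, .d] | .d => [.b, .g, .a, .d]
def VU : Q → List Q
  | .a => [.a] | .b => [.b] | .g => [.a, .g] | .d => [.a, .d]


def inW (c c' d' : ℕ) : List Q → ℕ → ℕ
  | [], _ => 0
  | k :: w, p => if p < len c' d' k then inE c (k, p) else inW c c' d' w (p - len c' d' k)

def outW (d c' d' : ℕ) : List Q → ℕ → ℕ
  | [], _ => 0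
  | k :: w, p => if p < len c' d' k then outE d (k, p) else outW d c' d' w (p - len c' d' k)

theorem inE_walk (c c' d' : ℕ) (hc : c ≠ 0) : ∀ (w : List Q) (p : ℕ),
    inE c (walk c' d' w p) = inW c c' d' w p
  | [], p => by simp [walk, inW, inE, hc.symm]
  | k :: w, p => by
    rw [walk, inW, ← inE_walk c c' d' hc w]; split_ifs <;> rfl

theorem outE_walk (d c' d' : ℕ) : ∀ (w : List Q) (p : ℕ),
    outE d (walk c' d' w p) = outW d c' d' w p
  | [], p => by simp [walk, outW, outE]
  | k :: w, p => by
    rw [walk, outW, ← outE_walk d c' d' w]; split_ifs <;> rfl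

theorem ev1 {lam mu : ℕ} (hl : 0 < lam) (hm : 0 < mu) (k : Q) (j : ℕ)
    (hj : j < len (5 * lam + 3 * mu) (8 * lam + 5 * mu) k) :
    inE (5 * lam + 3 * mu) (k, j) = inE (2 * lam + mu)
    (phi (2 * lam + mu) (3 * lam + 2 * mu) .d (5 * lam + 3 * mu) VL (k, j)) := by
  rw [phi, inE_walk _ _ _ (by omega)]
  cases k <;> simp only [VL, inW, inE, len, List.cons_append, List.nil_append] at hj ⊢ <;>
    grind (splits := 40)

theorem ev2 {lam mu : ℕ} (hl : 0 < lam) (hm : 0 < mu) (k : Q) (j : ℕ)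
    (hj : j < len (5 * lam + 3 * mu) (8 * lam + 5 * mu) k) :
    outE (3 * lam + 2 * mu)
      (phi (2 * lam + mu) (3 * lam + 2 * mu) .d (5 * lam + 3 * mu) VL (k, j)) =
    inE (lam + mu) (phi (lam + mu) (2 * lam + mu) .g (3 * lam + 2 * mu) VM (k, j)) := by
  rw [phi, phi, inE_walk _ _ _ (by omega), outE_walk]
  cases k <;> simp only [VL, VM, inW, outW, inE, outE, len, List.cons_append, List.nil_append] at hj ⊢ <;>
    grind (splits := 40)

theorem ev3 {lam mu : ℕ} (hl : 0 < lam) (hm : 0 < mu) (k : Q) (j : ℕ)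
    (hj : j < len (5 * lam + 3 * mu) (8 * lam + 5 * mu) k) :
    outE (2 * lam + mu)
      (phi (lam + mu) (2 * lam + mu) .g (3 * lam + 2 * mu) VM (k, j)) =
    inE (2 * lam + mu) (phi (2 * lam + mu) (3 * lam + 2 * mu) .g (8 * lam + 5 * mu) VU (k, j)) := by
  rw [phi, phi, inE_walk _ _ _ (by omega), outE_walk]
  cases k <;> simp only [VU, VM, inW, outW, inE, outE, len, List.cons_append, List.nil_append] at hj ⊢ <;>
    grind (splits := 40)

theorem ev4 {lam mu : ℕ} (hl : 0 < lam) (hm : 0 < mu) (k : Q) (j : ℕ)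
    (hj : j < len (5 * lam + 3 * mu) (8 * lam + 5 * mu) k) :
    outE (8 * lam + 5 * mu) (k, j) = outE (3 * lam + 2 * mu)
    (phi (2 * lam + mu) (3 * lam + 2 * mu) .g (8 * lam + 5 * mu) VU (k, j)) := by
  rw [phi, outE_walk]
  cases k <;> simp only [VU, outW, outE, len, List.cons_append, List.nil_append] at hj ⊢ <;>
    grind (splits := 40)

theorem expand {lam mu : ℕ} (hl : 0 < lam) (hm : 0 < mu) {e0 e3}
    (h : Rs (5 * lam + 3 * mu) (8 * lam + 5 * mu) e0 e3) :
    ∃ e1 e2, Rs (2 * lam + mu) (3 * lam + 2 * mu) e0 e1 ∧ Rs (lam + mu) (2 * lam + mu) e1 e2 ∧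
      Rs (2 * lam + mu) (3 * lam + 2 * mu) e2 e3 := by
  obtain ⟨st, hst, rfl, rfl⟩ := h
  set sL := fun t => phi (2 * lam + mu) (3 * lam + 2 * mu) .d (5 * lam + 3 * mu) VL (st t) with hL
  set sM := fun t => phi (lam + mu) (2 * lam + mu) .g (3 * lam + 2 * mu) VM (st t) with hM
  set sU := fun t => phi (2 * lam + mu) (3 * lam + 2 * mu) .g (8 * lam + 5 * mu) VU (st t) with hU
  have rL : SRow (2 * lam + mu) (3 * lam + 2 * mu) sL :=
    phi_row (by omega) (by omega) (by simp only [len]; omega)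
      (fun k => by cases k <;> simp [VL, tot, len] <;> ring) hst
  have rM : SRow (lam + mu) (2 * lam + mu) sM :=
    phi_row (by omega) (by omega) (by simp only [len]; omega)
      (fun k => by cases k <;> simp [VM, tot, len] <;> ring) hst
  have rU : SRow (2 * lam + mu) (3 * lam + 2 * mu) sU :=
    phi_row (by omega) (by omega) (by simp only [len]; omega)
      (fun k => by cases k <;> simp [VU, tot, len] <;> ring) hst
  refine ⟨_, _, ⟨sL, rL, ?_, rfl⟩, ⟨sM, rM, ?_, rfl⟩, ⟨sU, rU, ?_, ?_⟩⟩
  · funext t; exact ev1 hl hm _ _ (hst t).1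
  · funext t; exact ev2 hl hm _ _ (hst t).1
  · funext t; exact ev3 hl hm _ _ (hst t).1
  · funext t; exact ev4 hl hm _ _ (hst t).1

end JR


namespace JR

/-! ### The three smallest rows, as explicit tables of tiles -/

def succs (c d : ℕ) (s : St) : List St :=
  if s.2 + 1 < len c d s.1 then [(s.1, s.2 + 1)] else [(.a, 0), (.b, 0), (.g, 0), (.d, 0)]

def states (c d : ℕ) : List St :=
  [Q.a, Q.b, Q.g, Q.d].flatMap fun k => (List.range (len c d k)).map fun j => (k, j)

theorem mem_succs {c d : ℕ} {s s' : St} (h : Nx c d s s') : s' ∈ succs c d s := by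
  unfold succs
  rcases h with ⟨h1, h2⟩ | ⟨h1, h2⟩
  · rw [if_pos h1]; simp [h2]
  · rw [if_neg (by omega)]
    rcases s' with ⟨k, j⟩
    simp only at h2; subst h2
    cases k <;> simp

theorem mem_states {c d : ℕ} {s : St} (h : s.2 < len c d s.1) : s ∈ states c d := by
  rcases s with ⟨k, j⟩
  simp only [states, List.mem_flatMap, List.mem_map, List.mem_range]
  exact ⟨k, by cases k <;> simp, j, h, rfl⟩

/-- The tile in position `j` of loop `k`: hexadecimal digit `j` of the number `N k`. -/
def tileAt (N : Q → ℕ) (s : St) : Ed := (X0 ++ X1).getD (N s.1 / 16 ^ s.2 % 16) ⟨0, 0, 0, 0⟩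

def qd (x y z w : ℕ) : Q → ℕ
  | .a => x
  | .b => y
  | .g => z
  | .d => w

def rowOK (c d : ℕ) (X : List Ed) (f : St → Ed) : Bool :=
  (states c d).all fun s => X.contains (f s) && (succs c d s).all fun s' => (f s).e == (f s').w

theorem rowOK_sound {c d : ℕ} {X f} (h : rowOK c d X f = true) {st} (hst : SRow c d st) :
    RelW X (fun t => (f (st t)).s) (fun t => (f (st t)).n) := by
  refine ⟨fun t => f (st t), fun t => ?_, fun _ => rfl, fun _ => rfl⟩
  simp only [rowOK, List.all_eq_true, Bool.and_eq_true, List.contains_iff_mem, beq_iff_eq] at h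
  have := h _ (mem_states (hst t).1)
  exact ⟨this.1, this.2 _ (mem_succs (hst t).2)⟩

def XT : Bool → List Ed
  | true => X1
  | false => X0

def pathOK (c d : ℕ) : List (Bool × (Q → ℕ)) → (St → ℕ) → (St → ℕ) → Bool
  | [], p, q => (states c d).all fun s => p s == q s
  | (b, N) :: L, p, q => rowOK c d (XT b) (tileAt N) &&
      ((states c d).all fun s => p s == (tileAt N s).s) && pathOK c d L (fun s => (tileAt N s).n) q

theorem pathOK_sound {c d : ℕ} {st} (hst : SRow c d st) : ∀ {L p q}, pathOK c d L p q = true →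
    Path RT (L.map Prod.fst) (fun t => p (st t)) (fun t => q (st t))
  | [], p, q, h => by
    simp only [pathOK, List.all_eq_true, beq_iff_eq] at h
    simp only [List.map_nil, Path]
    funext t
    exact h _ (mem_states (hst t).1)
  | (b, N) :: L, p, q, h => by
    simp only [pathOK, Bool.and_eq_true] at h
    obtain ⟨⟨h1, h2⟩, h3⟩ := h
    simp only [List.all_eq_true, beq_iff_eq] at h2
    refine ⟨_, ?_, pathOK_sound hst h3⟩
    have e : (fun t => p (st t)) = fun t => (tileAt N (st t)).s := by
      funext t; exact h2 _ (mem_states (hst t).1)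
    rw [e]
    have := rowOK_sound h1 hst
    cases b <;> exact this

def winOK (c d : ℕ) (F : ℕ → ℕ → ℕ → ℕ → ℕ) (ev p : St → ℕ) : Bool :=
  (states c d).all fun s0 => (succs c d s0).all fun s1 => (succs c d s1).all fun s2 =>
    (succs c d s2).all fun s3 => F (ev s0) (ev s1) (ev s2) (ev s3) == p s3

theorem winOK_sound {c d : ℕ} {F ev p} (h : winOK c d F ev p = true) {st} (hst : SRow c d st)
    (t : ℤ) : F (ev (st (t - 3))) (ev (st (t - 2))) (ev (st (t - 1))) (ev (st t)) = p (st t) := by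
  simp only [winOK, List.all_eq_true, beq_iff_eq] at h
  have h0 := hst (t - 3)
  have h1 := hst (t - 2)
  have h2 := hst (t - 1)
  rw [show t - 3 + 1 = t - 2 by ring] at h0
  rw [show t - 2 + 1 = t - 1 by ring] at h1
  rw [show t - 1 + 1 = t by ring] at h2
  exact h _ (mem_states h0.1) _ (mem_succs h0.2) _ (mem_succs h1.2) _ (mem_succs h2.2)

/-! ### Letters from events -/

def W1 (e : Wd) : Wd := fun t => if e t ≠ 0 ∨ e (t - 1) ≠ 0 ∨ e (t - 2) = 3 then 1 else 0

def W0 (e : Wd) : Wd := fun t => if e t ≠ 0 ∨ e (t - 1) ≠ 0 ∨ e (t + 1) = 3 then 0 else 1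

def Fb1 (_ x1 x2 x3 : ℕ) : ℕ := if x3 ≠ 0 ∨ x2 ≠ 0 ∨ x1 = 3 then 1 else 0
def Ft1 (_ x1 x2 x3 : ℕ) : ℕ := if x2 ≠ 0 ∨ x1 ≠ 0 ∨ x3 = 3 then 0 else 1
def Fb0 (x0 x1 x2 _ : ℕ) : ℕ := if x1 ≠ 0 ∨ x0 ≠ 0 ∨ x2 = 3 then 0 else 1
def Ft0 (x0 x1 x2 _ : ℕ) : ℕ := if x2 ≠ 0 ∨ x1 ≠ 0 ∨ x0 = 3 then 1 else 0

def bot (L : List (Bool × (Q → ℕ))) (s : St) : ℕ := (tileAt (L.headD (true, fun _ => 0)).2 s).s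
def top (L : List (Bool × (Q → ℕ))) (s : St) : ℕ := (tileAt (L.getLastD (true, fun _ => 0)).2 s).n

theorem base_odd {c d : ℕ} {L} (h1 : pathOK c d L (bot L) (top L) = true)
    (h2 : winOK c d Fb1 (inE c) (bot L) = true) (h3 : winOK c d Ft1 (outE d) (top L) = true)
    {I O} (h : Rs c d I O) : Path RT (L.map Prod.fst) (sh 1 (W1 I)) (W0 O) := by
  obtain ⟨st, hst, rfl, rfl⟩ := h
  have := (pathOK_sound hst h1).shift RT_equi 1
  convert this using 1
  · funext t
    simp only [sh, ← winOK_sound h2 hst, Fb1, W1]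
  · funext t
    simp only [sh, ← winOK_sound h3 hst, Ft1, W0]
    rw [show t + 1 - 1 = t by ring, show t + 1 - 2 = t - 1 by ring]

theorem base_even {c d : ℕ} {L} (h1 : pathOK c d L (bot L) (top L) = true)
    (h2 : winOK c d Fb0 (inE c) (bot L) = true) (h3 : winOK c d Ft0 (outE d) (top L) = true)
    {I O} (h : Rs c d I O) : Path RT (L.map Prod.fst) (sh (-1) (W0 I)) (W1 O) := by
  obtain ⟨st, hst, rfl, rfl⟩ := h
  have := (pathOK_sound hst h1).shift RT_equi 1
  convert this using 1
  · funext t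
    simp only [sh, ← winOK_sound h2 hst, Fb0, W0]
    rw [show t + 1 - 1 = t + -1 + 1 by ring, show t + 1 - 2 = t + -1 by ring,
      show t + 1 - 3 = t + -1 - 1 by ring]
  · funext t
    simp only [sh, ← winOK_sound h3 hst, Ft0, W1]
    rw [show t + 1 - 1 = t by ring, show t + 1 - 2 = t - 1 by ring,
      show t + 1 - 3 = t - 2 by ring]

def tab1 : List (Bool × (Q → ℕ)) :=
  [(true, qd 694698 699050 2863241642 2863311530),
   (false, qd 144241 160881 658715505 658969201),
   (false, qd 291110 292885 1199862054 1199657254),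
   (false, qd 529685 528389 2170033429 2164262165)]

def tab2 : List (Bool × (Q → ℕ)) :=
  [(true, qd 2594806169 2576980377 2702159794313625 2702159776422297),
   (false, qd 927150899 858993459 900719990420275 900719925474099),
   (false, qd 1199862055 1192390951 1250312533078311 1250312534126887),
   (false, qd 2170033479 2169579079 2274968500442439 2274968552871239),
   (false, qd 1409 333185 347892352385 349369795969),
   (true, qd 2863311257 2863241625 3002326737136025 3002326450874777),
   (false, qd 1898398515 1898132275 1990336988005171 1990335948866355),
   (false, qd 642221169 642191985 673387089724529 673387106501745),
   (false, qd 360798229 360796454 378322555066389 378323393927189),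
   (false, qd 0 1296 0 23639097344)]

def tab3 : List (Bool × (Q → ℕ)) :=
  [(true, qd 3002399733754538 3002399751580330 12895208742556044243937962 12895208742556044530199210),
   (false, qd 1990601968390772 1990602036548212 8549570646325568126521972 8549570646325569165660788),
   (false, qd 370699819705464 370699826975864 1592143633494195653731448 1592143633494194814870648),
   (false, qd 5589922043920 5589916735504 24008509566376406505488 24008509566352767408144),
   (true, qd 3001226939177370 3001226940291482 12890171556426058179385754 12890171556426062759565722),
   (false, qd 320177786008375 320177790268215 1375153138107514172420919 1375153138107530798641975),
   (false, qd 1766994448819986 1766994449286930 7589183371900896823813906 7589183371900896555378450),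
   (false, qd 1549574675436129 1549574675464529 6655372553829980562592353 6655372553829967140819553),
   (false, qd 378225578240 378225557504 1624466400369272967424 1624466399991047409920),
   (true, qd 3002326468696490 3002326468700842 12894893994985213578090922 12894893994985286860970410),
   (false, qd 690713269515121 690713269531761 2966590903551881364255601 2966590903552147383792497),
   (false, qd 1258146553426214 1258146553427989 5403698300548544502984998 5403698300548329754620198),
   (false, qd 2275444973376789 2275444973375493 9772961744501364661687573 9772961744495313052767509)]

theorem base1 {I O} (h : Rs 2 3 I O) : Path RT (tab1.map Prod.fst) (sh 1 (W1 I)) (W0 O) :=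
  base_odd (by decide +kernel) (by decide +kernel) (by decide +kernel) h

theorem base2 {I O} (h : Rs 3 5 I O) : Path RT (tab2.map Prod.fst) (sh (-1) (W0 I)) (W1 O) :=
  base_even (by decide +kernel) (by decide +kernel) (by decide +kernel) h

theorem base3 {I O} (h : Rs 5 8 I O) : Path RT (tab3.map Prod.fst) (sh 1 (W1 I)) (W0 O) :=
  base_odd (by decide +kernel) (by decide +kernel) (by decide +kernel) h

def Lt (n : ℕ) (e : Wd) : Wd := if n % 2 = 1 then W1 e else W0 e

theorem tower (n : ℕ) (hn : 1 ≤ n) {I O} (h : Rs (Nat.fib (n + 2)) (Nat.fib (n + 3)) I O) :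
    ∃ s l, Path RT l (sh s (Lt n I)) (Lt (n + 1) O) ∧ n ≤ 3 * l.length ∧ 1 ≤ l.length := by
  induction n using Nat.strong_induction_on generalizing I O with
  | _ n ih =>
    match n, hn, h with
    | 1, _, h => exact ⟨1, _, base1 h, by decide, by decide⟩
    | 2, _, h => exact ⟨-1, _, base2 h, by decide, by decide⟩
    | 3, _, h => exact ⟨1, _, base3 h, by decide, by decide⟩
    | m + 4, _, h =>
      have f3 : Nat.fib (m + 3) = Nat.fib (m + 1) + Nat.fib (m + 2) := Nat.fib_add_two
      have f4 : Nat.fib (m + 4) = Nat.fib (m + 2) + Nat.fib (m + 3) := Nat.fib_add_two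
      have f5 : Nat.fib (m + 5) = Nat.fib (m + 3) + Nat.fib (m + 4) := Nat.fib_add_two
      have f6 : Nat.fib (m + 6) = Nat.fib (m + 4) + Nat.fib (m + 5) := Nat.fib_add_two
      have f7 : Nat.fib (m + 7) = Nat.fib (m + 5) + Nat.fib (m + 6) := Nat.fib_add_two
      have h' : Rs (5 * Nat.fib (m + 2) + 3 * Nat.fib (m + 1))
          (8 * Nat.fib (m + 2) + 5 * Nat.fib (m + 1)) I O := by
        convert h using 1
        · show _ = Nat.fib (m + 6); omega
        · show _ = Nat.fib (m + 7); omega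
      obtain ⟨e1, e2, a1, a2, a3⟩ := expand (Nat.fib_pos.2 (by omega)) (Nat.fib_pos.2 (by omega)) h'
      rw [show 2 * Nat.fib (m + 2) + Nat.fib (m + 1) = Nat.fib (m + 2 + 2) by
          show _ = Nat.fib (m + 4); omega,
        show 3 * Nat.fib (m + 2) + 2 * Nat.fib (m + 1) = Nat.fib (m + 2 + 3) by
          show _ = Nat.fib (m + 5); omega] at a1 a3
      rw [show 2 * Nat.fib (m + 2) + Nat.fib (m + 1) = Nat.fib (m + 1 + 3) by
          show _ = Nat.fib (m + 4); omega,
        show Nat.fib (m + 2) + Nat.fib (m + 1) = Nat.fib (m + 1 + 2) by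
          show _ = Nat.fib (m + 3); omega] at a2
      obtain ⟨s1, l1, p1, q1, r1⟩ := ih (m + 2) (by omega) (by omega) a1
      obtain ⟨s2, l2, p2, q2, r2⟩ := ih (m + 1) (by omega) (by omega) a2
      obtain ⟨s3, l3, p3, q3, r3⟩ := ih (m + 2) (by omega) (by omega) a3
      have p1' := (p1.shift RT_equi s2).shift RT_equi s3
      have p2' := p2.shift RT_equi s3
      refine ⟨s3 + (s2 + s1), l1 ++ (l2 ++ l3), ?_, by simp only [List.length_append]; omega,
        by simp only [List.length_append]; omega⟩
      rw [path_append]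
      refine ⟨sh s3 (sh s2 (Lt (m + 1) e1)), ?_, ?_⟩
      rotate_left
      · rw [path_append]
        refine ⟨_, p2', ?_⟩
        convert p3 using 1
        · simp only [Lt]; rw [show (m + 4 + 1) % 2 = (m + 2 + 1) % 2 by omega]
      · convert p1' using 1
        · rw [sh_sh, sh_sh]
          simp only [Lt]; rw [show (m + 4) % 2 = (m + 2) % 2 by omega]
          congr 1; ring
        · simp only [Lt]; rw [show (m + 1) % 2 = (m + 2 + 1) % 2 by omega]

theorem start (c d : ℕ) (hc : 0 < c) : ∃ I O, Rs c d I O := by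
  refine ⟨_, _, fun t => (.a, (t % ((c + d : ℕ) : ℤ)).toNat), fun t => ?_, rfl, rfl⟩
  have p : (0 : ℤ) < ((c + d : ℕ) : ℤ) := by exact_mod_cast (by omega : 0 < c + d)
  generalize hK : ((c + d : ℕ) : ℤ) = K at p
  have h1 := Int.emod_nonneg t p.ne'
  have h2 := Int.emod_lt_of_pos t p
  have hl : len c d .a = c + d := rfl
  refine ⟨by simp only [hl]; omega, ?_⟩
  simp only [Nx, hl]
  by_cases h : t % K + 1 = K
  · refine Or.inr ⟨by omega, ?_⟩
    have : (t + 1) % K = 0 := by rw [← Int.emod_add_emod, h, Int.emod_self]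
    simp [this]
  · refine Or.inl ⟨by omega, ?_⟩
    have : (t + 1) % K = t % K + 1 := by
      rw [← Int.emod_add_emod, Int.emod_eq_of_lt (by omega) (by omega)]
    rw [this, Prod.mk.injEq]
    exact ⟨rfl, by omega⟩

theorem long_path (n : ℕ) : ∃ l u v, Path RT l u v ∧ n ≤ l.length := by
  obtain ⟨I, O, h⟩ := start (Nat.fib (3 * n + 1 + 2)) (Nat.fib (3 * n + 1 + 3))
    (Nat.fib_pos.2 (by omega))
  obtain ⟨s, l, p, q, -⟩ := tower (3 * n + 1) (by omega) h
  exact ⟨l, _, _, p, by omega⟩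

end JR


namespace JR

/-! ### From long strips to a tiling of the plane -/

theorem strip_of_path : ∀ {l : List Bool} {u v}, Path RT l u v → ∃ F : ℤ → ℕ → Ed,
    (∀ x y, y < l.length → F x y ∈ X0 ++ X1 ∧ (F x y).e = (F (x + 1) y).w) ∧
    (∀ x y, y + 1 < l.length → (F x y).n = (F x (y + 1)).s) ∧
    (0 < l.length → ∀ x, u x = (F x 0).s)
  | [], u, v, _ => ⟨fun _ _ => ⟨0, 0, 0, 0⟩, by simp, by simp, by simp⟩
  | b :: l, u, v, ⟨w, h, hp⟩ => by
    obtain ⟨F, h1, h2, h3⟩ := strip_of_path hp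
    obtain ⟨r, k1, k2, k3⟩ : RelW (X0 ++ X1) u w := by
      cases b
      · exact RelW.mono (show RelW X0 u w from h) fun e he => List.mem_append_left _ he
      · exact RelW.mono (show RelW X1 u w from h) fun e he => List.mem_append_right _ he
    refine ⟨fun x y => Nat.casesOn y (r x) (fun y => F x y), ?_, ?_, ?_⟩
    · intro x y hy
      cases y with
      | zero => exact k1 x
      | succ y => exact h1 x y (by simpa using hy)
    · intro x y hy
      cases y with
      | zero =>
        show (r x).n = (F x 0).s
        rw [← k3, h3 (by simpa using hy)]
      | succ y => exact h2 x y (by simpa using hy)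
    · intro _ x
      exact k2 x

def wt (e : Ed) : WT := ⟨Fin.ofNat 4 e.w, Fin.ofNat 4 e.e, Fin.ofNat 5 e.s, Fin.ofNat 5 e.n⟩

theorem wt_mem {e : Ed} (h : e ∈ X0 ++ X1) : wt e ∈ T11 := by
  simp only [X0, X1, List.cons_append, List.nil_append, List.mem_cons, List.not_mem_nil,
    or_false] at h
  simp only [T11, T₀, T₁, Set.mem_union, Set.mem_insert_iff, Set.mem_singleton_iff]
  rcases h with h | h | h | h | h | h | h | h | h | h | h <;> subst h <;> decide

theorem strips (N : ℕ) : ∃ g : ℤ × ℤ → WT, ∀ x y : ℤ, -N ≤ y → y < N →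
    g (x, y) ∈ T11 ∧ (g (x, y)).east = (g (x + 1, y)).west ∧
      (g (x, y)).north = (g (x, y + 1)).south := by
  obtain ⟨l, u, v, hp, hl⟩ := long_path (2 * N + 1)
  obtain ⟨F, h1, h2, -⟩ := strip_of_path hp
  refine ⟨fun p => wt (F p.1 (p.2 + N).toNat), fun x y hy1 hy2 => ⟨?_, ?_, ?_⟩⟩
  · exact wt_mem (h1 _ _ (by simp only; omega)).1
  · have := (h1 x (y + N).toNat (by omega)).2
    simp only [wt, this]
  · have := h2 x (y + N).toNat (by omega)
    simp only [wt]
    rw [this, show (y + 1 + N).toNat = (y + N).toNat + 1 by omega]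

theorem WT_finite : Finite WT :=
  Finite.of_injective (fun t : WT => (t.west, t.east, t.south, t.north)) (by
    rintro ⟨a, b, c, d⟩ ⟨a', b', c', d'⟩ h
    simp only [Prod.mk.injEq] at h
    obtain ⟨rfl, rfl, rfl, rfl⟩ := h
    rfl)

theorem tiles : TilesPlane T11 := by
  have := WT_finite
  choose g hg using strips
  have hlim : ∀ p, ∃ t, ∀ᶠ N in (Filter.hyperfilter ℕ : Filter ℕ), g N p = t := by
    intro p
    obtain ⟨t, ht⟩ := ((Filter.hyperfilter ℕ).map (fun N => g N p)).eq_pure_of_finite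
    refine ⟨t, ?_⟩
    have : ({t} : Set WT) ∈ (Filter.hyperfilter ℕ).map (fun N => g N p) := by
      rw [ht]; exact Set.mem_singleton t
    exact this
  choose f hf using hlim
  have hlarge : ∀ y : ℤ, ∀ᶠ N : ℕ in (Filter.hyperfilter ℕ : Filter ℕ), -(N : ℤ) ≤ y ∧ y < N := by
    intro y
    have : ∀ᶠ N : ℕ in Filter.atTop, -(N : ℤ) ≤ y ∧ y < N := by
      filter_upwards [Filter.eventually_ge_atTop (y.natAbs + 1)] with N hN
      omega
    exact this.filter_mono Nat.hyperfilter_le_atTop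
  refine ⟨f, fun p _ => ?_, fun x y _ _ => ?_, fun x y _ _ => ?_⟩
  · obtain ⟨N, h1, h2⟩ := ((hf p).and (hlarge p.2)).exists
    rw [← h1]; exact (hg N p.1 p.2 h2.1 h2.2).1
  · obtain ⟨N, h1, h2, h3⟩ := ((hf (x, y)).and ((hf (x + 1, y)).and (hlarge y))).exists
    rw [← h1, ← h2]; exact (hg N x y h3.1 h3.2).2.1
  · obtain ⟨N, h1, h2, h3⟩ := ((hf (x, y)).and ((hf (x, y + 1)).and (hlarge y))).exists
    rw [← h1, ← h2]; exact (hg N x y h3.1 h3.2).2.2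

end JR

/-- the 11-tile Wang set `𝒯` is aperiodic: it tiles the plane and no
tiling of the plane by it is periodic. -/
theorem T11_aperiodic : Aperiodic T11 := by
  exact ⟨JR.tiles, fun _ hf => JR.no_periodic hf⟩
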